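/- For every nonzero element f of the Fpbar-linear span of {f_{-n,1} : n >= 1} inside ind_K^G 1, there exists a nonzero G-equivariant map S_f : ind_K^G st -> ind_K^G 1 with S_f(f_{0,st}) = f; moreover the assignment f -> S_f defines an isomorphism of Fpbar-vector spaces from span{f_{-n,1} : n >= 1} onto Hom_G(ind_K^G st, ind_K^G 1). -/

import Mathlib

open scoped Classical

noncomputable section

namespace U21

/-- The arithmetic setting: `E` is the unramified quadratic extension of a non-archimedean
local field `F` of odd residue characteristic `p`, with residue field of `F` of cardinality
`q = p ^ fdeg`.  The field `E` is encoded through its valuation subring `O = o_E`, a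
uniformizer `ϖ`, the maximal ideal `mI` (so that `p_E^k` is `ϖ ^ k * O`), and the nontrivial
`F`-automorphism `conj` of `E` (which induces the `q`-power Frobenius on the residue field
of `E`, of cardinality `q ^ 2`). -/
structure Setting where
  p : ℕ
  q : ℕ
  fdeg : ℕ
  hp : p.Prime
  hodd : p ≠ 2
  hfdeg : 0 < fdeg
  hq : q = p ^ fdeg
  E : Type
  [fieldE : Field E]
  conj : E →+* E
  conj_invol : ∀ x, conj (conj x) = x
  conj_ne : conj ≠ RingHom.id E
  O : Subring E
  val_ring : ∀ x : E, x ≠ 0 → x ∈ O ∨ x⁻¹ ∈ O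
  conj_O : ∀ x, x ∈ O → conj x ∈ O
  ϖ : E
  unif_mem : ϖ ∈ O
  unif_ne : ϖ ≠ 0
  unif_conj : conj ϖ = ϖ
  unif_not_unit : ¬ IsUnit (⟨ϖ, unif_mem⟩ : O)
  disc : ∀ x : E, x ≠ 0 → ∃ (n : ℤ) (u : Oˣ), x = (u : O) * ϖ ^ n
  mI : Ideal O
  hmI : ∀ x : O, x ∈ mI ↔ ∃ y ∈ O, (x : E) = ϖ * y
  [fin_res : Fintype (O ⧸ mI)]
  card_res : Fintype.card (O ⧸ mI) = q ^ 2
  res_frob : ∀ x : O, Ideal.Quotient.mk mI ⟨conj x, conj_O x x.2⟩ = (Ideal.Quotient.mk mI x) ^ q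
  complete : ∀ a : ℕ → E,
    (∀ k : ℕ, ∃ N, ∀ m ≥ N, ∀ n ≥ N, ∃ w ∈ O, a m - a n = ϖ ^ k * w) →
    ∃ L : E, ∀ k : ℕ, ∃ N, ∀ n ≥ N, ∃ w ∈ O, a n - L = ϖ ^ k * w

attribute [instance] Setting.fieldE Setting.fin_res

namespace Setting

variable (S : Setting)

/-- 3×3 matrices over `E`. -/
abbrev M3 := Matrix (Fin 3) (Fin 3) S.E

/-- The antidiagonal matrix `β` of the Hermitian form. -/
def betaM : S.M3 := !![0,0,1;0,1,0;1,0,0]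

/-- The fractional ideal `p_E ^ k ⊆ E` (for `k : ℤ`). -/
def pE (k : ℤ) : Set S.E := {z | ∃ w ∈ S.O, z = S.ϖ ^ k * w}

/-- The unramified unitary group `G = U(2,1)(E/F)`, as a subgroup of `GL₃(E)`:
`g ∈ G` iff `g.transpose * β * conj g = β`. -/
def Gsub : Subgroup (Matrix.GeneralLinearGroup (Fin 3) S.E) where
  carrier := {g | ((g : S.M3)).transpose * S.betaM * ((g : S.M3).map S.conj) = S.betaM}
  one_mem' := by
    simp [Matrix.map_one (⇑S.conj) (map_zero S.conj) (map_one S.conj)]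
  mul_mem' := by
    intro a b ha hb
    simp only [Set.mem_setOf_eq, Units.val_mul, Matrix.transpose_mul, Matrix.map_mul] at ha hb ⊢
    calc ((b : S.M3)).transpose * ((a : S.M3)).transpose * S.betaM * ((a : S.M3).map S.conj * (b : S.M3).map S.conj)
        = ((b : S.M3)).transpose * (((a : S.M3)).transpose * S.betaM * (a : S.M3).map S.conj) * ((b : S.M3).map S.conj) := by
          simp only [mul_assoc]
      _ = S.betaM := by rw [ha]; exact hb
  inv_mem' := by
    intro a ha
    simp only [Set.mem_setOf_eq] at ha ⊢
    have hA : IsUnit ((a : S.M3)) := a.isUnit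
    have hdet : IsUnit ((a : S.M3)).det := (Matrix.isUnit_iff_isUnit_det _).mp hA
    have hAc : IsUnit (((a : S.M3)).map ⇑S.conj) := by
      rw [← RingHom.mapMatrix_apply]; exact hA.map _
    have hdetc : IsUnit ((((a : S.M3)).map ⇑S.conj).det) := (Matrix.isUnit_iff_isUnit_det _).mp hAc
    have hdetT : IsUnit ((((a : S.M3)).transpose).det) := by rw [Matrix.det_transpose]; exact hdet
    have hmapinv : ((a : S.M3)⁻¹).map ⇑S.conj = (((a : S.M3)).map ⇑S.conj)⁻¹ := by
      symm
      apply Matrix.inv_eq_left_inv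
      rw [← Matrix.map_mul, Matrix.nonsing_inv_mul _ hdet,
        Matrix.map_one (⇑S.conj) (map_zero S.conj) (map_one S.conj)]
    rw [Matrix.coe_units_inv, Matrix.transpose_nonsing_inv, hmapinv]
    conv_lhs => rw [← ha]
    calc (((a:S.M3)).transpose)⁻¹ * (((a:S.M3)).transpose * S.betaM * ((a:S.M3)).map ⇑S.conj) * (((a:S.M3)).map ⇑S.conj)⁻¹
        = (((a:S.M3)).transpose)⁻¹ * ((a:S.M3)).transpose * S.betaM *
            (((a:S.M3)).map ⇑S.conj * (((a:S.M3)).map ⇑S.conj)⁻¹) := by simp only [mul_assoc]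
      _ = S.betaM := by
          rw [Matrix.nonsing_inv_mul _ hdetT, Matrix.mul_nonsing_inv _ hdetc, one_mul, mul_one]

/-- The group `G = U(2,1)(E/F)`. -/
abbrev GG := ↥S.Gsub

/-- The matrix of an element of `G`. -/
def mat (g : S.GG) : S.M3 := ((g : Matrix.GeneralLinearGroup (Fin 3) S.E) : S.M3)

/-- The upper unipotent matrix `n(x,y)`. -/
def nM (x y : S.E) : S.M3 := !![1, x, y; 0, 1, -S.conj x; 0, 0, 1]

/-- The lower unipotent matrix `n'(x,y)`. -/
def n'M (x y : S.E) : S.M3 := !![1, 0, 0; x, 1, 0; y, -S.conj x, 1]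

/-- The diagonal matrix `h(x) = diag(x, -x̄x⁻¹, x̄⁻¹)`. -/
def hM (x : S.E) : S.M3 := !![x, 0, 0; 0, -S.conj x * x⁻¹, 0; 0, 0, (S.conj x)⁻¹]

/-- The subgroup `N` of `G` (unipotent radical of the upper triangular Borel), as a set. -/
def Nset : Set S.GG := {g | ∃ x y : S.E, x * S.conj x + y + S.conj y = 0 ∧ S.mat g = S.nM x y}

/-- The subgroup `N_k = {n(x,y) : y ∈ p_E^k}`, as a set. -/
def Nk (k : ℤ) : Set S.GG :=
  {g | ∃ x y : S.E, x * S.conj x + y + S.conj y = 0 ∧ y ∈ S.pE k ∧ S.mat g = S.nM x y}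

/-- The subgroup `N'` of `G`, as a set. -/
def N'set : Set S.GG := {g | ∃ x y : S.E, x * S.conj x + y + S.conj y = 0 ∧ S.mat g = S.n'M x y}

/-- The subgroup `N'_k = {n'(x,y) : y ∈ p_E^k}`, as a set. -/
def N'k (k : ℤ) : Set S.GG :=
  {g | ∃ x y : S.E, x * S.conj x + y + S.conj y = 0 ∧ y ∈ S.pE k ∧ S.mat g = S.n'M x y}

/-- The diagonal subgroup `H` of `G`, as a set. -/
def Hset : Set S.GG := {g | ∃ a b c : S.E, S.mat g = !![a,0,0;0,b,0;0,0,c]}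

/-- The hyperspecial maximal compact subgroup `K₀ = G ∩ GL₃(o_E)`, as a set. -/
def K0set : Set S.GG := {g | ∀ i j, S.mat g i j ∈ S.O}

/-- The special (non-hyperspecial) maximal compact subgroup `K₁`, as a set. -/
def K1set : Set S.GG :=
  {g | S.mat g 0 0 ∈ S.O ∧ S.mat g 0 1 ∈ S.O ∧ S.mat g 0 2 ∈ S.pE (-1) ∧
       S.mat g 1 0 ∈ S.pE 1 ∧ S.mat g 1 1 ∈ S.O ∧ S.mat g 1 2 ∈ S.O ∧
       S.mat g 2 0 ∈ S.pE 1 ∧ S.mat g 2 1 ∈ S.pE 1 ∧ S.mat g 2 2 ∈ S.O}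

/-- The Iwahori subgroup `I_{K₀}` (preimage of the Borel of `Γ_{K₀}`), as a set. -/
def IK0 : Set S.GG :=
  {g | g ∈ S.K0set ∧ S.mat g 1 0 ∈ S.pE 1 ∧ S.mat g 2 0 ∈ S.pE 1 ∧ S.mat g 2 1 ∈ S.pE 1}

/-- The pro-p Iwahori subgroup `I_{1,K₀}`, as a set. -/
def I1K0 : Set S.GG :=
  {g | g ∈ S.IK0 ∧ S.mat g 0 0 - 1 ∈ S.pE 1 ∧ S.mat g 1 1 - 1 ∈ S.pE 1 ∧ S.mat g 2 2 - 1 ∈ S.pE 1}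

/-- The opposite pro-p Iwahori subgroup `I'_{1,K₀}`, as a set. -/
def I1'K0 : Set S.GG :=
  {g | g ∈ S.K0set ∧ S.mat g 0 1 ∈ S.pE 1 ∧ S.mat g 0 2 ∈ S.pE 1 ∧ S.mat g 1 2 ∈ S.pE 1 ∧
       S.mat g 0 0 - 1 ∈ S.pE 1 ∧ S.mat g 1 1 - 1 ∈ S.pE 1 ∧ S.mat g 2 2 - 1 ∈ S.pE 1}

/-- The maximal normal pro-p subgroup `K₀¹` of `K₀` (principal congruence subgroup), as a set. -/
def Kone0 : Set S.GG := {g | ∀ i j, S.mat g i j - (1 : S.M3) i j ∈ S.pE 1}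

/-- The Iwahori subgroup `I_{K₁}`, as a set. -/
def IK1 : Set S.GG := {g | g ∈ S.K1set ∧ S.mat g 2 0 ∈ S.pE 2}

/-- The pro-p Iwahori subgroup `I_{1,K₁}`, as a set. -/
def I1K1 : Set S.GG :=
  {g | g ∈ S.IK1 ∧ S.mat g 0 0 - 1 ∈ S.pE 1 ∧ S.mat g 1 1 - 1 ∈ S.pE 1 ∧ S.mat g 2 2 - 1 ∈ S.pE 1}

/-- The opposite pro-p Iwahori subgroup `I'_{1,K₁}`, as a set. -/
def I1'K1 : Set S.GG :=
  {g | g ∈ S.K1set ∧ S.mat g 0 2 ∈ S.O ∧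
       S.mat g 0 0 - 1 ∈ S.pE 1 ∧ S.mat g 1 1 - 1 ∈ S.pE 1 ∧ S.mat g 2 2 - 1 ∈ S.pE 1}

/-- The maximal normal pro-p subgroup `K₁¹` of `K₁`, as a set. -/
def Kone1 : Set S.GG :=
  {g | g ∈ S.K1set ∧ S.mat g 0 2 ∈ S.O ∧ S.mat g 2 0 ∈ S.pE 2 ∧
       S.mat g 0 0 - 1 ∈ S.pE 1 ∧ S.mat g 1 1 - 1 ∈ S.pE 1 ∧ S.mat g 2 2 - 1 ∈ S.pE 1}

/-- The congruence subgroup of level `n` (used to express smoothness), as a set. -/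
def cong (n : ℕ) : Set S.GG := {g | ∀ i j, S.mat g i j - (1 : S.M3) i j ∈ S.pE n}

def alphaM : S.M3 := !![S.ϖ⁻¹, 0, 0; 0, 1, 0; 0, 0, S.ϖ]

def alphaMinv : S.M3 := !![S.ϖ, 0, 0; 0, 1, 0; 0, 0, S.ϖ⁻¹]

lemma alpha_mul_inv : S.alphaM * S.alphaMinv = 1 := by
  ext i j
  fin_cases i <;> fin_cases j <;>
    simp [alphaM, alphaMinv, Matrix.mul_apply, Fin.sum_univ_three, Matrix.one_apply,
      Matrix.vecHead, Matrix.vecTail, inv_mul_cancel₀ S.unif_ne, mul_inv_cancel₀ S.unif_ne]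

lemma alpha_inv_mul : S.alphaMinv * S.alphaM = 1 := by
  ext i j
  fin_cases i <;> fin_cases j <;>
    simp [alphaM, alphaMinv, Matrix.mul_apply, Fin.sum_univ_three, Matrix.one_apply,
      Matrix.vecHead, Matrix.vecTail, inv_mul_cancel₀ S.unif_ne, mul_inv_cancel₀ S.unif_ne]

def alphaU : Matrix.GeneralLinearGroup (Fin 3) S.E :=
  ⟨S.alphaM, S.alphaMinv, S.alpha_mul_inv, S.alpha_inv_mul⟩

lemma alphaU_mem : S.alphaU ∈ S.Gsub := by
  show ((S.alphaU : S.M3)).transpose * S.betaM * ((S.alphaU : S.M3).map S.conj) = S.betaM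
  have : (S.alphaU : S.M3) = S.alphaM := rfl
  rw [this]
  ext i j
  fin_cases i <;> fin_cases j <;>
    simp [alphaM, betaM, Matrix.mul_apply, Fin.sum_univ_three, Matrix.map_apply,
      Matrix.transpose_apply, Matrix.vecHead, Matrix.vecTail, map_inv₀, S.unif_conj,
      inv_mul_cancel₀ S.unif_ne, mul_inv_cancel₀ S.unif_ne]

/-- The element `α = diag(ϖ⁻¹, 1, ϖ)` of `G`. -/
def alphaE : S.GG := ⟨S.alphaU, S.alphaU_mem⟩

lemma beta_mul_beta : S.betaM * S.betaM = 1 := by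
  ext i j
  fin_cases i <;> fin_cases j <;>
    simp [betaM, Matrix.mul_apply, Fin.sum_univ_three, Matrix.one_apply,
      Matrix.vecHead, Matrix.vecTail]

def betaU : Matrix.GeneralLinearGroup (Fin 3) S.E :=
  ⟨S.betaM, S.betaM, S.beta_mul_beta, S.beta_mul_beta⟩

lemma betaU_mem : S.betaU ∈ S.Gsub := by
  show ((S.betaU : S.M3)).transpose * S.betaM * ((S.betaU : S.M3).map S.conj) = S.betaM
  have : (S.betaU : S.M3) = S.betaM := rfl
  rw [this]
  ext i j
  fin_cases i <;> fin_cases j <;>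
    simp [betaM, Matrix.mul_apply, Fin.sum_univ_three, Matrix.map_apply, Matrix.transpose_apply,
      Matrix.vecHead, Matrix.vecTail]

/-- The element `β` of `G`. -/
def betaE : S.GG := ⟨S.betaU, S.betaU_mem⟩

/-- The element `β' = β * α⁻¹` of `G`. -/
def betaPr : S.GG := S.betaE * S.alphaE⁻¹

/-- A finite set `U` is a set of representatives for the cosets `A/B`. -/
def IsReps (A B : Set S.GG) (U : Finset S.GG) : Prop :=
  (↑U : Set S.GG) ⊆ A ∧ ∀ a ∈ A, ∃! u, u ∈ U ∧ a⁻¹ * u ∈ B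

/-- The residue field `k_E` of `E`. -/
abbrev kE := S.O ⧸ S.mI

/-- The residue map `o_E → k_E`. -/
def resmap : S.O →+* S.kE := Ideal.Quotient.mk S.mI

/-- The group `L_{q³} = {(x,t) ∈ k_E² : x x̄ + t + t̄ = 0}` (where `x̄ = x^q`). -/
def Lbig : Set (S.kE × S.kE) := {z | z.1 * z.1 ^ S.q + z.2 + z.2 ^ S.q = 0}

/-- The group `L_q = {(0,t) ∈ k_E² : t + t̄ = 0}`. -/
def Lsmall : Set (S.kE × S.kE) := {z | z.1 = 0 ∧ z.2 + z.2 ^ S.q = 0}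

/-- `L_{q^t}` for `t ∈ {1,3}`. -/
def Lof (t : ℕ) : Set (S.kE × S.kE) := if t = 3 then S.Lbig else S.Lsmall

end Setting

/-- A choice of one of the two maximal compact open subgroups `K ∈ {K₀, K₁}` of `G`,
together with its maximal normal pro-p subgroup `K¹`, the (pro-p) Iwahori subgroups
`I_K ⊇ I_{1,K}`, the opposite pro-p Iwahori `I'_{1,K}`, the element
`β_K ∈ K ∩ {β, β'}`, and the integers `n_K, m_K, t_K`. -/
structure Chamber (S : Setting) where
  K : Subgroup S.GG
  KoneS : Set S.GG
  IK : Set S.GG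
  I1 : Set S.GG
  I1' : Set S.GG
  βK : S.GG
  nK : ℤ
  mK : ℤ
  tK : ℕ
  cases :
    ((K : Set S.GG) = S.K0set ∧ KoneS = S.Kone0 ∧ IK = S.IK0 ∧ I1 = S.I1K0 ∧ I1' = S.I1'K0 ∧
      βK = S.betaE ∧ nK = 0 ∧ mK = 1 ∧ tK = 3) ∨
    ((K : Set S.GG) = S.K1set ∧ KoneS = S.Kone1 ∧ IK = S.IK1 ∧ I1 = S.I1K1 ∧ I1' = S.I1'K1 ∧
      βK = S.betaPr ∧ nK = -1 ∧ mK = 2 ∧ tK = 1)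

namespace Chamber

variable {S : Setting} (C : Chamber S)

/-- `H₀ = H ∩ I_K`. -/
def H0 : Set S.GG := S.Hset ∩ C.IK

/-- `H₁ = H ∩ I_{1,K}`. -/
def H1 : Set S.GG := S.Hset ∩ C.I1

end Chamber

section RepTheory

variable {S : Setting} (C : Chamber S)
variable (𝔽 : Type) [Field 𝔽]

section Generic

variable {G₀ : Type} [Monoid G₀] {V : Type} [AddCommGroup V] [Module 𝔽 V]

/-- A submodule is invariant under a representation. -/
def Invt (ρ : Representation 𝔽 G₀ V) (Ssub : Submodule 𝔽 V) : Prop :=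
  ∀ g v, v ∈ Ssub → ρ g v ∈ Ssub

/-- The subrepresentation generated by a vector (the span of its orbit). -/
def orbitSpan (ρ : Representation 𝔽 G₀ V) (v : V) : Submodule 𝔽 V :=
  Submodule.span 𝔽 {w | ∃ g, w = ρ g v}

/-- The subrepresentation generated by a vector under a subset `A` of the group. -/
def orbitSpanOn (ρ : Representation 𝔽 G₀ V) (A : Set G₀) (v : V) : Submodule 𝔽 V :=
  Submodule.span 𝔽 {w | ∃ g ∈ A, w = ρ g v}

/-- The quotient of a representation by an invariant submodule `N` is irreducible:
equivalently (by the lattice correspondence), `N ≠ ⊤` and any invariant submodule lying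
between `N` and `⊤` equals `N` or `⊤`. -/
def QuotientIrreducible (ρ : Representation 𝔽 G₀ V) (N : Submodule 𝔽 V) : Prop :=
  N ≠ ⊤ ∧ ∀ Ssub : Submodule 𝔽 V, Invt 𝔽 ρ Ssub → N ≤ Ssub → Ssub = N ∨ Ssub = ⊤

/-- The submodule of vectors invariant under all elements of the subset `A`. -/
def invariantsOn (ρ : Representation 𝔽 G₀ V) (A : Set G₀) : Submodule 𝔽 V where
  carrier := {v | ∀ g ∈ A, ρ g v = v}
  add_mem' := by
    intro a b ha hb g hg
    rw [map_add, ha g hg, hb g hg]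
  zero_mem' := by
    intro g hg
    rw [map_zero]
  smul_mem' := by
    intro c a ha g hg
    rw [map_smul, ha g hg]

/-- The space `Hom_G(ρ₁, ρ₂)` of equivariant linear maps, as a submodule of the linear maps. -/
def EquivHomSub {V₂ : Type} [AddCommGroup V₂] [Module 𝔽 V₂]
    (ρ₁ : Representation 𝔽 G₀ V) (ρ₂ : Representation 𝔽 G₀ V₂) :
    Submodule 𝔽 (V →ₗ[𝔽] V₂) where
  carrier := {φ | ∀ g x, φ (ρ₁ g x) = ρ₂ g (φ x)}
  add_mem' := by
    intro a b ha hb g x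
    simp only [LinearMap.add_apply, ha g x, hb g x, map_add]
  zero_mem' := by
    intro g x
    simp only [LinearMap.zero_apply, map_zero]
  smul_mem' := by
    intro c a ha g x
    simp only [LinearMap.smul_apply, ha g x, map_smul]

end Generic

section Weight

variable (W : Type) [AddCommGroup W] [Module 𝔽 W]
variable (σ : Representation 𝔽 ↥C.K W)

/-- Extension of `σ` to all of `G` (by `1` outside `K`); used to avoid coercion issues. -/
def sigma' : S.GG → Module.End 𝔽 W := fun g => if h : g ∈ C.K then σ ⟨g, h⟩ else 1

/-- `σ` is a weight of `K`: an irreducible smooth representation of `K` over `𝔽`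
factoring through `Γ_K = K / K¹` (automatically finite dimensional). -/
def IsWeight : Prop :=
  Nontrivial W ∧ FiniteDimensional 𝔽 W ∧
  (∀ Ssub : Submodule 𝔽 W, (∀ (k : ↥C.K) (w : W), w ∈ Ssub → σ k w ∈ Ssub) → Ssub = ⊥ ∨ Ssub = ⊤) ∧
  (∀ (g : S.GG) (hg : g ∈ C.K), g ∈ C.KoneS → σ ⟨g, hg⟩ = LinearMap.id)

/-- `σ` is one dimensional of the form `χ ∘ det`. -/
def IsDetWeight : Prop :=
  Module.finrank 𝔽 W = 1 ∧
  ∃ c : S.E → 𝔽, ∀ (g : S.GG) (hg : g ∈ C.K) (w : W), σ ⟨g, hg⟩ w = c ((S.mat g).det) • w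

/-- `j_σ : σ → σ` is the composition of the coinvariant projection `σ → σ_{I'_{1,K}}`
with the inverse of the natural isomorphism `σ^{I_{1,K}} ≅ σ_{I'_{1,K}}`:
it restricts to the identity on `σ^{I_{1,K}}` and kills the augmentation part of
`σ` with respect to `I'_{1,K}`. -/
def IsJ (jσ : W →ₗ[𝔽] W) : Prop :=
  (∀ w : W, (∀ g ∈ C.I1, sigma' C 𝔽 W σ g w = w) → jσ w = w) ∧
  (∀ (w : W) (g : S.GG), g ∈ C.I1' → jσ (sigma' C 𝔽 W σ g w - w) = 0)

/-- The defining conditions of the compact induction `ind_K^G σ`: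
`K`-equivariance on the left and compact support (finitely many cosets `K g`). -/
def IndCarrier : Set (S.GG → W) :=
  {f | (∀ (k : S.GG) (hk : k ∈ C.K) (g : S.GG), f (k * g) = σ ⟨k, hk⟩ (f g)) ∧
       ∃ s : Finset S.GG, ∀ g : S.GG, f g ≠ 0 → ∃ k ∈ C.K, ∃ t ∈ s, g = k * t}

/-- The compact induction `ind_K^G σ`, as a submodule of `G → W`. -/
def IndSub : Submodule 𝔽 (S.GG → W) where
  carrier := IndCarrier C 𝔽 W σ
  add_mem' := by
    rintro f g ⟨hf1, sf, hf2⟩ ⟨hg1, sg, hg2⟩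
    refine ⟨fun k hk x => by simp [hf1 k hk x, hg1 k hk x], sf ∪ sg, fun x hx => ?_⟩
    by_cases h : f x ≠ 0
    · obtain ⟨k, hk, t, ht, rfl⟩ := hf2 x h
      exact ⟨k, hk, t, Finset.mem_union_left _ ht, rfl⟩
    · push_neg at h
      have hgx : g x ≠ 0 := by
        intro h0
        apply hx
        simp [Pi.add_apply, h, h0]
      obtain ⟨k, hk, t, ht, rfl⟩ := hg2 x hgx
      exact ⟨k, hk, t, Finset.mem_union_right _ ht, rfl⟩
  zero_mem' := ⟨fun k hk g => by simp, ∅, fun g hg => absurd rfl hg⟩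
  smul_mem' := by
    rintro c f ⟨hf1, sf, hf2⟩
    refine ⟨fun k hk g => by simp [hf1 k hk g], sf, fun x hx => ?_⟩
    refine hf2 x ?_
    intro h0
    apply hx
    simp [h0]

lemma indAct_mem (g : S.GG) {f : S.GG → W} (hf : f ∈ IndCarrier C 𝔽 W σ) :
    (fun x => f (x * g)) ∈ IndCarrier C 𝔽 W σ := by
  obtain ⟨h1, s, h2⟩ := hf
  refine ⟨fun k hk x => ?_, s.image (· * g⁻¹), ?_⟩
  · show f (k * x * g) = _
    rw [mul_assoc]
    exact h1 k hk (x * g)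
  intro x hx
  obtain ⟨k, hk, t, ht, hxg⟩ := h2 (x * g) hx
  refine ⟨k, hk, t * g⁻¹, Finset.mem_image_of_mem _ ht, ?_⟩
  rw [← mul_assoc, ← hxg, mul_assoc, mul_inv_cancel, mul_one]

/-- The representation of `G` on `ind_K^G σ` by right translation. -/
def indRep : Representation 𝔽 S.GG ↥(IndSub C 𝔽 W σ) where
  toFun g :=
    { toFun := fun f => ⟨fun x => (f : S.GG → W) (x * g), indAct_mem C 𝔽 W σ g f.2⟩
      map_add' := fun f1 f2 => Subtype.ext (funext fun x => rfl)
      map_smul' := fun c f => Subtype.ext (funext fun x => rfl) }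
  map_one' := LinearMap.ext fun f => Subtype.ext (funext fun x => by simp [mul_one])
  map_mul' g h := LinearMap.ext fun f => Subtype.ext (funext fun x => by simp [mul_assoc])

/-- The function `[g, v] ∈ ind_K^G σ`: supported on `K g⁻¹`, with value `v` at `g⁻¹`. -/
def stdFn (g : S.GG) (v : W) : S.GG → W :=
  fun x => if h : x * g ∈ C.K then σ ⟨x * g, h⟩ v else 0

/-- The characterization of the family `f_n` (`n ∈ ℤ`) of `I_{1,K}`-invariant elements of
`ind_K^G σ`: `f_n` is supported on `K α⁻ⁿ I_{1,K}` and has value at `α⁻ⁿ` equal to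
`σ(β_K) v₀` for `n > 0` and `v₀` for `n ≤ 0`, where `v₀` is a fixed nonzero vector of
`σ^{I_{1,K}}`. -/
def IsFFamily (v0 : W) (ff : ℤ → ↥(IndSub C 𝔽 W σ)) : Prop :=
  v0 ≠ 0 ∧ (∀ g ∈ C.I1, sigma' C 𝔽 W σ g v0 = v0) ∧
  (∀ (n : ℤ) (g : S.GG), g ∈ C.I1 → indRep C 𝔽 W σ g (ff n) = ff n) ∧
  (∀ (n : ℤ) (x : S.GG), (ff n : S.GG → W) x ≠ 0 →
    ∃ k ∈ C.K, ∃ i ∈ C.I1, x = k * S.alphaE ^ (-n) * i) ∧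
  (∀ n : ℤ, 0 < n → (ff n : S.GG → W) (S.alphaE ^ (-n)) = sigma' C 𝔽 W σ C.βK v0) ∧
  (∀ n : ℤ, n ≤ 0 → (ff n : S.GG → W) (S.alphaE ^ (-n)) = v0)

/-- The characterization of the Hecke operator `T ∈ End_G(ind_K^G σ)`:
it is `G`-equivariant and satisfies
`T [1, v] = ∑_{u ∈ N_{n_K}/N_{n_K+2}} [u α⁻¹, j_σ σ(u⁻¹) v]
  + ∑_{u ∈ N_{n_K+1}/N_{n_K+2}} [β_K u α⁻¹, j_σ σ(β_K) v]`. -/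
def IsHeckeT (jσ : W →ₗ[𝔽] W) (T : Module.End 𝔽 ↥(IndSub C 𝔽 W σ)) : Prop :=
  (∀ (g : S.GG) (x : ↥(IndSub C 𝔽 W σ)),
    T (indRep C 𝔽 W σ g x) = indRep C 𝔽 W σ g (T x)) ∧
  (∀ (v : W) (x : ↥(IndSub C 𝔽 W σ)), (x : S.GG → W) = stdFn C 𝔽 W σ 1 v →
    ∀ (U2 U1 : Finset S.GG),
      S.IsReps (S.Nk C.nK) (S.Nk (C.nK + 2)) U2 →
      S.IsReps (S.Nk (C.nK + 1)) (S.Nk (C.nK + 2)) U1 →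
      ((T x : S.GG → W)) =
        (∑ u ∈ U2, stdFn C 𝔽 W σ (u * S.alphaE⁻¹) (jσ (sigma' C 𝔽 W σ u⁻¹ v))) +
        ∑ u ∈ U1, stdFn C 𝔽 W σ (C.βK * u * S.alphaE⁻¹) (jσ (sigma' C 𝔽 W σ C.βK v)))

/-- The eigencharacter `χ_σ` of `H₀/H₁` afforded by the (one-dimensional) space
`σ^{I_{1,K}}` with chosen basis vector `v₀`. -/
def IsChi (v0 : W) (χ : S.GG → 𝔽) : Prop :=
  (∀ h ∈ C.H0, sigma' C 𝔽 W σ h v0 = χ h • v0)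

/-- Right translation on functions `K → 𝔽` (the action on a (finite) principal series). -/
def PSact (k : ↥C.K) (f : ↥C.K → 𝔽) : ↥C.K → 𝔽 := fun x => f (x * k)

/-- The (inflation to `K` of the) finite principal series `Ind_𝔹^{Γ_K} χ`:
functions on `K`, invariant under right translation by `K¹`, left `I_{1,K}`-invariant and
left `(H₀, χ)`-equivariant. -/
def PSchiSub (χ : S.GG → 𝔽) : Submodule 𝔽 (↥C.K → 𝔽) where
  carrier := {f | (∀ b : ↥C.K, (b : S.GG) ∈ C.I1 → ∀ x, f (b * x) = f x) ∧
                  (∀ h : ↥C.K, (h : S.GG) ∈ C.H0 → ∀ x, f (h * x) = χ (h : S.GG) * f x) ∧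
                  (∀ z : ↥C.K, (z : S.GG) ∈ C.KoneS → ∀ x, f (x * z) = f x)}
  add_mem' := by
    rintro f g ⟨hf1, hf2, hf3⟩ ⟨hg1, hg2, hg3⟩
    exact ⟨fun b hb x => by simp [hf1 b hb x, hg1 b hb x],
           fun h hh x => by simp [hf2 h hh x, hg2 h hh x, mul_add],
           fun z hz x => by simp [hf3 z hz x, hg3 z hz x]⟩
  zero_mem' := ⟨fun b hb x => rfl, fun h hh x => by simp, fun z hz x => rfl⟩
  smul_mem' := by
    rintro c f ⟨hf1, hf2, hf3⟩
    refine ⟨fun b hb x => by simp [hf1 b hb x], fun h hh x => ?_, fun z hz x => by simp [hf3 z hz x]⟩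
    simp only [Pi.smul_apply, hf2 h hh x, smul_eq_mul]
    ring

/-- The principal series `Ind_𝔹^{Γ_K} 1` for the trivial character. -/
def PS1sub : Submodule 𝔽 (↥C.K → 𝔽) := PSchiSub C 𝔽 (fun _ => 1)

/-- `σ_{st}` is the Steinberg weight `st = (Ind_𝔹^{Γ_K} 1)/1`: there is a surjective
`K`-equivariant linear map from `Ind_𝔹^{Γ_K} 1` to it whose kernel is exactly the
constant functions. -/
def IsSteinberg {Wst : Type} [AddCommGroup Wst] [Module 𝔽 Wst]
    (σst : Representation 𝔽 ↥C.K Wst) : Prop :=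
  ∃ φ : ↥(PS1sub C 𝔽) →ₗ[𝔽] Wst, Function.Surjective φ ∧
    (∀ f : ↥(PS1sub C 𝔽), φ f = 0 ↔ ∃ c : 𝔽, (f : ↥C.K → 𝔽) = fun _ => c) ∧
    (∀ (k : ↥C.K) (f f' : ↥(PS1sub C 𝔽)),
      (f' : ↥C.K → 𝔽) = PSact C 𝔽 k (f : ↥C.K → 𝔽) → φ f' = σst k (φ f))

/-- `σ` is isomorphic to a twist of the Steinberg weight by a character. -/
def IsTwistSteinberg : Prop :=
  ∃ (c : ↥C.K →* 𝔽ˣ) (φ : ↥(PS1sub C 𝔽) →ₗ[𝔽] W), Function.Surjective φ ∧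
    (∀ f : ↥(PS1sub C 𝔽), φ f = 0 ↔ ∃ cc : 𝔽, (f : ↥C.K → 𝔽) = fun _ => cc) ∧
    (∀ (k : ↥C.K) (f f' : ↥(PS1sub C 𝔽)),
      (f' : ↥C.K → 𝔽) = PSact C 𝔽 k (f : ↥C.K → 𝔽) →
        φ f' = (c k : 𝔽) • σ k (φ f))


/-- The `K`-subrepresentation of the quotient `(ind_K^G σ) / (range T)` generated by the
image of a vector `v`. -/
def genQuot (T : Module.End 𝔽 ↥(IndSub C 𝔽 W σ)) (v : ↥(IndSub C 𝔽 W σ)) :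
    Submodule 𝔽 (↥(IndSub C 𝔽 W σ) ⧸ LinearMap.range T) :=
  Submodule.span 𝔽 {w | ∃ k ∈ C.K, w = Submodule.Quotient.mk (indRep C 𝔽 W σ k v)}

end Weight

/-- Smoothness of a representation of `G`: every vector is fixed by some congruence
subgroup (equivalently, has open stabilizer). -/
def SmoothRep {V : Type} [AddCommGroup V] [Module 𝔽 V] (ρ : Representation 𝔽 S.GG V) : Prop :=
  ∀ v : V, ∃ n : ℕ, ∀ g ∈ S.cong n, ρ g v = v

end RepTheory

end U21

namespace U21

namespace Setting

variable {S : Setting}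

lemma mem_pE_zero {x : S.E} : x ∈ S.pE 0 ↔ x ∈ S.O := by
  constructor
  · rintro ⟨w, hw, rfl⟩
    simpa using hw
  · intro h
    exact ⟨x, h, by simp⟩

lemma unif_zpow_mem_O {n : ℤ} (hn : 0 ≤ n) : S.ϖ ^ n ∈ S.O := by
  lift n to ℕ using hn
  rw [zpow_natCast]
  exact S.O.pow_mem S.unif_mem n

lemma pE_mono {k l : ℤ} (h : k ≤ l) {x : S.E} (hx : x ∈ S.pE l) : x ∈ S.pE k := by
  obtain ⟨w, hw, rfl⟩ := hx
  refine ⟨S.ϖ ^ (l - k) * w, S.O.mul_mem (unif_zpow_mem_O (by omega)) hw, ?_⟩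
  rw [← mul_assoc, ← zpow_add₀ S.unif_ne]
  congr 2
  ring

lemma pE_add {k : ℤ} {x y : S.E} (hx : x ∈ S.pE k) (hy : y ∈ S.pE k) : x + y ∈ S.pE k := by
  obtain ⟨w, hw, rfl⟩ := hx
  obtain ⟨v, hv, rfl⟩ := hy
  exact ⟨w + v, S.O.add_mem hw hv, by ring⟩

lemma pE_zero_mem (k : ℤ) : (0 : S.E) ∈ S.pE k := ⟨0, S.O.zero_mem, by simp⟩

lemma pE_neg {k : ℤ} {x : S.E} (hx : x ∈ S.pE k) : -x ∈ S.pE k := by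
  obtain ⟨w, hw, rfl⟩ := hx
  exact ⟨-w, S.O.neg_mem hw, by ring⟩

lemma pE_sub {k : ℤ} {x y : S.E} (hx : x ∈ S.pE k) (hy : y ∈ S.pE k) : x - y ∈ S.pE k := by
  rw [sub_eq_add_neg]
  exact pE_add hx (pE_neg hy)

lemma pE_mul {k l : ℤ} {x y : S.E} (hx : x ∈ S.pE k) (hy : y ∈ S.pE l) :
    x * y ∈ S.pE (k + l) := by
  obtain ⟨w, hw, rfl⟩ := hx
  obtain ⟨v, hv, rfl⟩ := hy
  refine ⟨w * v, S.O.mul_mem hw hv, ?_⟩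
  rw [zpow_add₀ S.unif_ne]
  ring

lemma pE_mul' {k l m : ℤ} {x y : S.E} (hx : x ∈ S.pE k) (hy : y ∈ S.pE l) (h : m ≤ k + l) :
    x * y ∈ S.pE m :=
  pE_mono h (pE_mul hx hy)

lemma unif_zpow_mem_pE (k : ℤ) : S.ϖ ^ k ∈ S.pE k := ⟨1, S.O.one_mem, by simp⟩

lemma one_mem_pE : (1 : S.E) ∈ S.pE 0 := mem_pE_zero.2 S.O.one_mem

lemma conj_mem_pE {k : ℤ} {x : S.E} (hx : x ∈ S.pE k) : S.conj x ∈ S.pE k := by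
  obtain ⟨w, hw, rfl⟩ := hx
  exact ⟨S.conj w, S.conj_O w hw, by rw [map_mul, map_zpow₀, S.unif_conj]⟩

lemma conj_eq_zero {x : S.E} : S.conj x = 0 ↔ x = 0 := map_eq_zero S.conj

/-- `x` is a unit of the ring of integers. -/
def IsU (S : Setting) (x : S.E) : Prop := x ∈ S.O ∧ x⁻¹ ∈ S.O ∧ x ≠ 0

lemma IsU.conj {x : S.E} (hx : S.IsU x) : S.IsU (S.conj x) :=
  ⟨S.conj_O _ hx.1, by rw [← map_inv₀]; exact S.conj_O _ hx.2.1, by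
    simpa [conj_eq_zero] using hx.2.2⟩

lemma IsU.mul {x y : S.E} (hx : S.IsU x) (hy : S.IsU y) : S.IsU (x * y) :=
  ⟨S.O.mul_mem hx.1 hy.1, by rw [mul_inv]; exact S.O.mul_mem hx.2.1 hy.2.1,
    mul_ne_zero hx.2.2 hy.2.2⟩

lemma IsU.inv {x : S.E} (hx : S.IsU x) : S.IsU x⁻¹ :=
  ⟨hx.2.1, by simpa using hx.1, inv_ne_zero hx.2.2⟩

lemma exists_unit_mul_zpow {x : S.E} (hx : x ≠ 0) :
    ∃ (n : ℤ) (u : S.E), S.IsU u ∧ x = u * S.ϖ ^ n := by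
  obtain ⟨n, u, h⟩ := S.disc x hx
  have hu : ((u : S.O) : S.E) ≠ 0 := by
    intro h0
    rw [h0, zero_mul] at h
    exact hx h
  refine ⟨n, ((u : S.O) : S.E), ⟨(u : S.O).2, ?_, hu⟩, h⟩
  have h1 : ((u : S.O) : S.E) * (((u⁻¹ : S.Oˣ) : S.O) : S.E) = 1 := by
    have := u.mul_inv
    exact_mod_cast congrArg (Subtype.val) this
  rw [inv_eq_of_mul_eq_one_right h1]
  exact Subtype.property _

lemma IsU.mul_zpow_mem_pE_iff {u : S.E} (hu : S.IsU u) {n k : ℤ} :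
    u * S.ϖ ^ n ∈ S.pE k ↔ k ≤ n := by
  constructor
  · rintro ⟨w, hw, h⟩
    by_contra! hlt
    apply S.unif_not_unit
    have hmem : S.ϖ ^ (k - n - 1) * w * u⁻¹ ∈ S.O :=
      S.O.mul_mem (S.O.mul_mem (unif_zpow_mem_O (by omega)) hw) hu.2.1
    refine IsUnit.of_mul_eq_one ⟨_, hmem⟩ (Subtype.ext ?_)
    have e : S.ϖ ^ k = S.ϖ ^ (k - n - 1) * S.ϖ * S.ϖ ^ n := by
      rw [← zpow_add_one₀ S.unif_ne, ← zpow_add₀ S.unif_ne]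
      congr 1
      ring
    have hn : S.ϖ ^ n ≠ 0 := zpow_ne_zero _ S.unif_ne
    have h2 : u = S.ϖ ^ (k - n - 1) * S.ϖ * w := by
      apply mul_right_cancel₀ hn
      rw [h, e]
      ring
    show S.ϖ * (S.ϖ ^ (k - n - 1) * w * u⁻¹) = 1
    have hu0 := hu.2.2
    field_simp
    rw [h2]
    ring
  · intro h
    refine pE_mono h ?_
    rw [mul_comm]
    exact ⟨u, hu.1, rfl⟩

lemma IsU.not_mem_pE_one {u : S.E} (hu : S.IsU u) : u ∉ S.pE 1 := by
  have := hu.mul_zpow_mem_pE_iff (n := 0) (k := 1)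
  simp at this
  exact this

lemma isU_of_not_mem {x : S.E} (hx : x ∈ S.O) (h : x ∉ S.pE 1) : S.IsU x := by
  have hx0 : x ≠ 0 := by
    rintro rfl
    exact h (pE_zero_mem 1)
  obtain ⟨n, u, hu, rfl⟩ := exists_unit_mul_zpow hx0
  rw [← mem_pE_zero, hu.mul_zpow_mem_pE_iff] at hx
  rw [hu.mul_zpow_mem_pE_iff] at h
  obtain rfl : n = 0 := by omega
  simpa using hu

lemma one_ne_mem : (1 : S.E) ∉ S.pE 1 :=
  IsU.not_mem_pE_one ⟨S.O.one_mem, by simp, one_ne_zero⟩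

lemma isU_of_mul_sub_one {x y : S.E} (hx : x ∈ S.O) (hy : y ∈ S.O) (h : x * y - 1 ∈ S.pE 1) :
    S.IsU x := by
  refine isU_of_not_mem hx fun hx1 => one_ne_mem (S := S) ?_
  have := pE_sub (pE_mul' hx1 (mem_pE_zero.2 hy) (m := 1) (by omega)) h
  simpa using this

lemma mem_pE_of_norm {x : S.E} {k m : ℤ} (h : x * S.conj x ∈ S.pE m) (hk : 2 * k ≤ m + 1) :
    x ∈ S.pE k := by
  by_cases hx : x = 0
  · rw [hx]
    exact pE_zero_mem k
  obtain ⟨n, u, hu, rfl⟩ := exists_unit_mul_zpow hx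
  have e : u * S.ϖ ^ n * S.conj (u * S.ϖ ^ n) = (u * S.conj u) * S.ϖ ^ (n + n) := by
    rw [map_mul, map_zpow₀, S.unif_conj, zpow_add₀ S.unif_ne]
    ring
  rw [e, (hu.mul hu.conj).mul_zpow_mem_pE_iff] at h
  rw [hu.mul_zpow_mem_pE_iff]
  omega

lemma isU_of_norm_eq_one {x : S.E} (h : x * S.conj x = 1) : S.IsU x := by
  have hx : x ∈ S.O :=
    mem_pE_zero.1 (mem_pE_of_norm (m := 0) (by rw [h]; exact one_mem_pE) (by omega))
  refine ⟨hx, ?_, left_ne_zero_of_mul_eq_one h⟩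
  rw [inv_eq_of_mul_eq_one_right h]
  exact S.conj_O _ hx

lemma exists_isU_trace_zero (S : Setting) : ∃ u : S.E, S.IsU u ∧ u + S.conj u = 0 := by
  have : ∃ x, S.conj x ≠ x := by
    by_contra! h
    exact S.conj_ne (RingHom.ext h)
  obtain ⟨x, hx⟩ := this
  obtain ⟨n, u, hu, h⟩ := exists_unit_mul_zpow (sub_ne_zero.2 hx)
  refine ⟨u, hu, ?_⟩
  have h2 := congrArg S.conj h
  rw [map_mul, map_zpow₀, S.unif_conj, map_sub, S.conj_invol] at h2
  apply mul_right_cancel₀ (zpow_ne_zero n S.unif_ne)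
  rw [add_mul, ← h, ← h2]
  ring

lemma natCast_p_mem (S : Setting) : (S.p : S.E) ∈ S.pE 1 := by
  by_contra h
  have hO : (S.p : S.E) ∈ S.O := natCast_mem _ _
  have hu := isU_of_not_mem hO h
  have hunit : IsUnit ((S.p : ℕ) : S.O) :=
    IsUnit.of_mul_eq_one ⟨_, hu.2.1⟩ (Subtype.ext (by simpa using mul_inv_cancel₀ hu.2.2))
  have h1 : IsUnit ((S.q ^ 2 : ℕ) : S.O ⧸ S.mI) := by
    have := (hunit.map (Ideal.Quotient.mk S.mI)).pow (S.fdeg * 2)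
    rw [S.hq, ← pow_mul]
    simpa using this
  rw [← S.card_res, Nat.cast_card_eq_zero] at h1
  have h2 : Subsingleton (S.O ⧸ S.mI) := by
    have := isUnit_zero_iff.1 h1
    exact subsingleton_of_zero_eq_one this
  have h3 := Fintype.card_le_one_iff_subsingleton.2 h2
  rw [S.card_res, S.hq, ← pow_mul] at h3
  have := Nat.one_lt_pow (n := S.fdeg * 2) (by have := S.hfdeg; omega) S.hp.one_lt
  omega

lemma mk_eq_iff {x y : S.O} :
    Ideal.Quotient.mk S.mI x = Ideal.Quotient.mk S.mI y ↔ (x : S.E) - y ∈ S.pE 1 := by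
  rw [Ideal.Quotient.eq, S.hmI]
  simp [pE]

end Setting

namespace Setting

variable {S : Setting}

lemma mat_mul (g h : S.GG) : S.mat (g * h) = S.mat g * S.mat h := rfl

lemma mat_one : S.mat 1 = 1 := rfl

lemma mat_ext {g h : S.GG} (e : S.mat g = S.mat h) : g = h := Subtype.ext (Units.ext e)

lemma form_eq (g : S.GG) : (S.mat g).transpose * S.betaM * (S.mat g).map S.conj = S.betaM := g.2

lemma betaM_mul_apply (m : S.M3) (i j : Fin 3) : (S.betaM * m) i j = m i.rev j := by
  fin_cases i <;> simp [betaM, Matrix.mul_apply, Fin.sum_univ_three]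

lemma mul_betaM_apply (m : S.M3) (i j : Fin 3) : (m * S.betaM) i j = m i j.rev := by
  fin_cases j <;> simp [betaM, Matrix.mul_apply, Fin.sum_univ_three]

lemma form_apply (g : S.GG) (i j : Fin 3) :
    S.mat g 0 i * S.conj (S.mat g 2 j) + S.mat g 1 i * S.conj (S.mat g 1 j) +
      S.mat g 2 i * S.conj (S.mat g 0 j) = S.betaM i j := by
  conv_rhs => rw [← form_eq g]
  rw [mul_assoc, Matrix.mul_apply, Fin.sum_univ_three]
  simp only [betaM_mul_apply, Matrix.map_apply, Matrix.transpose_apply]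
  rfl

lemma transpose_betaM : (S.betaM).transpose = S.betaM := by
  ext i j
  fin_cases i <;> fin_cases j <;> rfl

/-- The inverse of a matrix preserving the Hermitian form. -/
def invM (m : S.M3) : S.M3 := S.betaM * (m.map S.conj).transpose * S.betaM

lemma invM_mul {m : S.M3} (h : m.transpose * S.betaM * m.map S.conj = S.betaM) :
    invM m * m = 1 := by
  have h1 := congrArg Matrix.transpose h
  rw [Matrix.transpose_mul, Matrix.transpose_mul, Matrix.transpose_transpose, transpose_betaM] at h1
  rw [invM, mul_assoc, mul_assoc, h1, beta_mul_beta]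

lemma invM_apply (m : S.M3) (i j : Fin 3) : invM m i j = S.conj (m j.rev i.rev) := by
  rw [invM, mul_assoc, betaM_mul_apply, mul_betaM_apply]
  rfl

/-- The element of `G` with a given matrix. -/
def ofMat (m : S.M3) (h : m.transpose * S.betaM * m.map S.conj = S.betaM) : S.GG :=
  ⟨⟨m, invM m, mul_eq_one_comm.1 (invM_mul h), invM_mul h⟩, h⟩

lemma mat_inv_apply (g : S.GG) (i j : Fin 3) :
    S.mat g⁻¹ i j = S.conj (S.mat g j.rev i.rev) := by
  have : g⁻¹ = (ofMat (S.mat g) (form_eq g))⁻¹ := congrArg _ (mat_ext rfl)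
  rw [this, ← invM_apply]
  rfl

lemma form_apply_row (g : S.GG) (i j : Fin 3) :
    S.mat g i 0 * S.conj (S.mat g j 2) + S.mat g i 1 * S.conj (S.mat g j 1) +
      S.mat g i 2 * S.conj (S.mat g j 0) = S.betaM i j := by
  have h := form_apply g⁻¹ j.rev i.rev
  simp only [mat_inv_apply, S.conj_invol, Fin.rev_rev] at h
  have e : S.betaM j.rev i.rev = S.betaM i j := by
    fin_cases i <;> fin_cases j <;> rfl
  rw [← e, ← h]
  have e0 : (0 : Fin 3).rev = 2 := rfl
  have e1 : (1 : Fin 3).rev = 1 := rfl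
  have e2 : (2 : Fin 3).rev = 0 := rfl
  rw [e0, e1, e2]
  ring

/-- The exponents of the diagonal of `α⁻¹`. -/
def wt : Fin 3 → ℤ := ![1, 0, -1]

lemma alphaM_eq : S.alphaM = Matrix.diagonal fun i => S.ϖ ^ (-wt i) := by
  ext i j
  fin_cases i <;> fin_cases j <;> simp [alphaM, wt]

lemma mat_alpha_zpow (n : ℤ) :
    S.mat (S.alphaE ^ n) = Matrix.diagonal fun i => S.ϖ ^ (-(n * wt i)) := by
  have hn : ∀ n : ℕ, S.mat (S.alphaE ^ n) = Matrix.diagonal fun i => S.ϖ ^ (-(n * wt i)) := by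
    intro n
    induction n with
    | zero => simp [mat_one]
    | succ n ih =>
      rw [pow_succ, mat_mul, ih, show S.mat S.alphaE = S.alphaM from rfl, alphaM_eq,
        Matrix.diagonal_mul_diagonal]
      congr 1
      funext i
      rw [← zpow_add₀ S.unif_ne]
      congr 1
      push_cast
      ring
  obtain ⟨m, rfl | rfl⟩ := n.eq_nat_or_neg
  · rw [zpow_natCast, hn]
  · ext i j
    rw [zpow_neg, zpow_natCast, mat_inv_apply, hn]
    fin_cases i <;> fin_cases j <;> simp [Matrix.diagonal, wt, S.unif_conj, Fin.ext_iff]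

lemma mat_alpha_mul_apply (n : ℤ) (g : S.GG) (i j : Fin 3) :
    S.mat (S.alphaE ^ n * g) i j = S.ϖ ^ (-(n * wt i)) * S.mat g i j := by
  rw [mat_mul, mat_alpha_zpow, Matrix.diagonal_mul]

lemma mat_mul_alpha_apply (n : ℤ) (g : S.GG) (i j : Fin 3) :
    S.mat (g * S.alphaE ^ n) i j = S.mat g i j * S.ϖ ^ (-(n * wt j)) := by
  rw [mat_mul, mat_alpha_zpow, Matrix.mul_diagonal]

lemma mat_beta_mul_apply (g : S.GG) (i j : Fin 3) :
    S.mat (S.betaE * g) i j = S.mat g i.rev j := betaM_mul_apply _ _ _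

lemma mat_mul_beta_apply (g : S.GG) (i j : Fin 3) :
    S.mat (g * S.betaE) i j = S.mat g i j.rev := mul_betaM_apply _ _ _

lemma wt_rev (i : Fin 3) : wt i.rev = -wt i := by
  fin_cases i <;> rfl

lemma alpha_zpow_mul_beta (n : ℤ) : S.alphaE ^ n * S.betaE = S.betaE * S.alphaE ^ (-n) := by
  apply mat_ext
  ext i j
  rw [mat_mul_beta_apply, mat_beta_mul_apply, mat_alpha_zpow, mat_alpha_zpow]
  fin_cases i <;> fin_cases j <;> simp [Matrix.diagonal, wt, Fin.ext_iff]

lemma beta_mul_self : S.betaE * S.betaE = 1 := mat_ext S.beta_mul_beta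

/-- The matrices whose entries lie in prescribed fractional ideals. -/
def MM (S : Setting) (e : Fin 3 → Fin 3 → ℤ) : Set S.M3 := {m | ∀ i j, m i j ∈ S.pE (e i j)}

lemma MM_mul {e e' e'' : Fin 3 → Fin 3 → ℤ} (h : ∀ i j k, e'' i k ≤ e i j + e' j k) {m m' : S.M3}
    (hm : m ∈ S.MM e) (hm' : m' ∈ S.MM e') : m * m' ∈ S.MM e'' := by
  intro i k
  rw [Matrix.mul_apply, Fin.sum_univ_three]
  exact pE_add (pE_add (pE_mul' (hm _ _) (hm' _ _) (h _ _ _)) (pE_mul' (hm _ _) (hm' _ _) (h _ _ _)))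
    (pE_mul' (hm _ _) (hm' _ _) (h _ _ _))

lemma MM_add {e : Fin 3 → Fin 3 → ℤ} {m m' : S.M3}
    (hm : m ∈ S.MM e) (hm' : m' ∈ S.MM e) : m + m' ∈ S.MM e :=
  fun i j => pE_add (hm i j) (hm' i j)

lemma MM_inv {e : Fin 3 → Fin 3 → ℤ} (h : ∀ i j, e i j = e j.rev i.rev) {g : S.GG}
    (hg : S.mat g ∈ S.MM e) : S.mat g⁻¹ ∈ S.MM e := by
  intro i j
  rw [mat_inv_apply, h]
  exact conj_mem_pE (hg _ _)

lemma MM_one {e : Fin 3 → Fin 3 → ℤ} (h : ∀ i, e i i ≤ 0) : (1 : S.M3) ∈ S.MM e := by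
  intro i j
  by_cases hij : i = j
  · subst hij
    rw [Matrix.one_apply_eq]
    exact pE_mono (h i) one_mem_pE
  · rw [Matrix.one_apply_ne hij]
    exact pE_zero_mem _

/-- Exponents of the order attached to the maximal compact subgroup `K_r`, `r ∈ {0, 1}`. -/
def eA (r : ℤ) : Fin 3 → Fin 3 → ℤ := ![![0, 0, -r], ![r, 0, 0], ![r, r, 0]]

/-- Exponents of the order attached to the Iwahori subgroup of `K_r`. -/
def eI (r : ℤ) : Fin 3 → Fin 3 → ℤ := ![![0, 0, -r], ![1, 0, 0], ![1 + r, 1, 0]]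

/-- Exponents of the radical of the order attached to `K_r`. -/
def eJ (r : ℤ) : Fin 3 → Fin 3 → ℤ := ![![1, 1 - r, 1 - r], ![1, 1, 1 - r], ![1 + r, 1, 1]]

lemma eI_trans {r : ℤ} (hr : r = 0 ∨ r = 1) (i j k : Fin 3) : eI r i k ≤ eI r i j + eI r j k := by
  revert i j k
  obtain rfl | rfl := hr <;> decide

lemma eA_eJ {r : ℤ} (hr : r = 0 ∨ r = 1) (i j k : Fin 3) : eJ r i k ≤ eA r i j + eJ r j k := by
  revert i j k
  obtain rfl | rfl := hr <;> decide

lemma eJ_eA {r : ℤ} (hr : r = 0 ∨ r = 1) (i j k : Fin 3) : eJ r i k ≤ eJ r i j + eA r j k := by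
  revert i j k
  obtain rfl | rfl := hr <;> decide

lemma eA_le_eI {r : ℤ} (hr : r = 0 ∨ r = 1) (i j : Fin 3) : eA r i j ≤ eI r i j := by
  revert i j
  obtain rfl | rfl := hr <;> decide

lemma eI_le_eJ {r : ℤ} (hr : r = 0 ∨ r = 1) (i j : Fin 3) : eI r i j ≤ eJ r i j := by
  revert i j
  obtain rfl | rfl := hr <;> decide

lemma eI_rev (r : ℤ) (i j : Fin 3) : eI r i j = eI r j.rev i.rev := by
  fin_cases i <;> fin_cases j <;> rfl

lemma eI_diag (r : ℤ) (i : Fin 3) : eI r i i ≤ 0 := by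
  fin_cases i <;> exact le_refl _

lemma MM_mono {e e' : Fin 3 → Fin 3 → ℤ} (h : ∀ i j, e i j ≤ e' i j) {m : S.M3}
    (hm : m ∈ S.MM e') : m ∈ S.MM e := fun i j => pE_mono (h i j) (hm i j)

lemma forall_fin_three {P : Fin 3 → Prop} : (∀ i, P i) ↔ P 0 ∧ P 1 ∧ P 2 := by
  constructor
  · intro h
    exact ⟨h 0, h 1, h 2⟩
  · rintro ⟨h0, h1, h2⟩ i
    fin_cases i <;> assumption

lemma mem_MM_iff {e : Fin 3 → Fin 3 → ℤ} {m : S.M3} : m ∈ S.MM e ↔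
    (m 0 0 ∈ S.pE (e 0 0) ∧ m 0 1 ∈ S.pE (e 0 1) ∧ m 0 2 ∈ S.pE (e 0 2)) ∧
    (m 1 0 ∈ S.pE (e 1 0) ∧ m 1 1 ∈ S.pE (e 1 1) ∧ m 1 2 ∈ S.pE (e 1 2)) ∧
    (m 2 0 ∈ S.pE (e 2 0) ∧ m 2 1 ∈ S.pE (e 2 1) ∧ m 2 2 ∈ S.pE (e 2 2)) := by
  rw [show m ∈ S.MM e ↔ ∀ i j, m i j ∈ S.pE (e i j) from Iff.rfl, forall_fin_three]
  simp only [forall_fin_three]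

/-- The Iwahori subgroup of `K_r`. -/
def Iw (S : Setting) {r : ℤ} (hr : r = 0 ∨ r = 1) : Subgroup S.GG where
  carrier := {g | S.mat g ∈ S.MM (eI r)}
  one_mem' := MM_one (eI_diag r)
  mul_mem' := fun ha hb => MM_mul (eI_trans hr) ha hb
  inv_mem' := fun ha => MM_inv (eI_rev r) ha

end Setting

/-- The uniform description of the two chambers, with `r = -n_K`. -/
structure IsLevel {S : Setting} (C : Chamber S) (r : ℤ) : Prop where
  hr : r = 0 ∨ r = 1
  mem_K : ∀ g, g ∈ C.K ↔ S.mat g ∈ S.MM (Setting.eA r)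
  mem_IK : ∀ g, g ∈ C.IK ↔ S.mat g ∈ S.MM (Setting.eI r)
  mem_I1 : ∀ g, g ∈ C.I1 ↔ S.mat g ∈ S.MM (Setting.eI r) ∧
    S.mat g 0 0 - 1 ∈ S.pE 1 ∧ S.mat g 1 1 - 1 ∈ S.pE 1 ∧ S.mat g 2 2 - 1 ∈ S.pE 1
  mem_Kone : ∀ g, g ∈ C.KoneS ↔ S.mat g - 1 ∈ S.MM (Setting.eJ r)
  beta_eq : C.βK = S.betaE * S.alphaE ^ (-r)

open Setting

lemma exists_isLevel {S : Setting} (C : Chamber S) : ∃ r, IsLevel C r := by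
  obtain ⟨hK, hone, hI, hI1, -, hb, -⟩ | ⟨hK, hone, hI, hI1, -, hb, -⟩ := C.cases
  · refine ⟨0, Or.inl rfl, ?_, ?_, ?_, ?_, ?_⟩
    · intro g
      rw [← SetLike.mem_coe, hK, mem_MM_iff]
      simp only [K0set, eA, Set.mem_ofPred_eq, forall_fin_three]
      simp [mem_pE_zero]
    · intro g
      rw [hI, mem_MM_iff]
      simp only [IK0, K0set, eI, Set.mem_ofPred_eq, forall_fin_three]
      simp [mem_pE_zero]
      have := @pE_mono S 0 1 (by omega)
      simp only [mem_pE_zero] at this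
      grind
    · intro g
      rw [hI1, mem_MM_iff]
      simp only [I1K0, IK0, K0set, eI, Set.mem_ofPred_eq, forall_fin_three]
      simp [mem_pE_zero]
      have := @pE_mono S 0 1 (by omega)
      simp only [mem_pE_zero] at this
      grind
    · intro g
      rw [hone, mem_MM_iff]
      simp only [Kone0, eJ, Set.mem_ofPred_eq, forall_fin_three, Matrix.sub_apply]
      simp
    · simpa using hb
  · have h10 := @pE_mono S 0 1 (by omega)
    have h21 := @pE_mono S 1 2 (by omega)
    have h01 := @pE_mono S (-1) 0 (by omega)
    simp only [mem_pE_zero] at h10 h01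
    refine ⟨1, Or.inr rfl, ?_, ?_, ?_, ?_, ?_⟩
    · intro g
      rw [← SetLike.mem_coe, hK, mem_MM_iff]
      simp only [K1set, eA, Set.mem_ofPred_eq]
      simp [mem_pE_zero]
      grind
    · intro g
      rw [hI, mem_MM_iff]
      simp only [IK1, K1set, eI, Set.mem_ofPred_eq]
      simp [mem_pE_zero]
      grind
    · intro g
      rw [hI1, mem_MM_iff]
      simp only [I1K1, IK1, K1set, eI, Set.mem_ofPred_eq]
      simp [mem_pE_zero]
      grind
    · intro g
      rw [hone, mem_MM_iff]
      have hd : ∀ x : S.E, x - 1 ∈ S.pE 1 → x ∈ S.O := fun x hx => by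
        simpa using S.O.add_mem (h10 hx) S.O.one_mem
      simp only [Kone1, K1set, eJ, Set.mem_ofPred_eq, Matrix.sub_apply]
      simp [mem_pE_zero]
      grind
    · rw [hb, betaPr, zpow_neg_one]

namespace Setting

variable {S : Setting}

lemma lower_form {x y : S.E} (h : x * S.conj x + y + S.conj y = 0) :
    (S.n'M x y).transpose * S.betaM * (S.n'M x y).map S.conj = S.betaM := by
  ext i j
  fin_cases i <;> fin_cases j <;>
    simp [n'M, betaM, Matrix.mul_apply, Fin.sum_univ_three, S.conj_invol]
  linear_combination h

/-- The lower unipotent element `n'(x,y)` of `G`. -/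
def lowN {x y : S.E} (h : x * S.conj x + y + S.conj y = 0) : S.GG :=
  ofMat (S.n'M x y) (lower_form h)

lemma mat_lowN {x y : S.E} (h : x * S.conj x + y + S.conj y = 0) :
    S.mat (lowN h) = S.n'M x y := rfl

lemma diag_form {d : Fin 3 → S.E} (h : ∀ i, d i * S.conj (d i.rev) = 1) :
    (Matrix.diagonal d).transpose * S.betaM * (Matrix.diagonal d).map S.conj = S.betaM := by
  have h0 := h 0
  have h1 := h 1
  have h2 := h 2
  simp only [show (0 : Fin 3).rev = 2 from rfl, show (1 : Fin 3).rev = 1 from rfl,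
    show (2 : Fin 3).rev = 0 from rfl] at h0 h1 h2
  ext i j
  fin_cases i <;> fin_cases j <;>
    simp [betaM, Matrix.mul_apply, Fin.sum_univ_three, h0, h1, h2, Matrix.diagonal]

/-- A diagonal element of `G`. -/
def diagG {d : Fin 3 → S.E} (h : ∀ i, d i * S.conj (d i.rev) = 1) : S.GG :=
  ofMat (Matrix.diagonal d) (diag_form h)

lemma mat_diagG {d : Fin 3 → S.E} (h : ∀ i, d i * S.conj (d i.rev) = 1) :
    S.mat (diagG h) = Matrix.diagonal d := rfl

lemma mat_diagG_inv {d : Fin 3 → S.E} (h : ∀ i, d i * S.conj (d i.rev) = 1) :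
    S.mat (diagG h)⁻¹ = Matrix.diagonal fun i => S.conj (d i.rev) := by
  ext i j
  rw [mat_inv_apply, mat_diagG]
  fin_cases i <;> fin_cases j <;> simp [Matrix.diagonal, Fin.ext_iff]

lemma diagG_inv_mul_apply {d : Fin 3 → S.E} (h : ∀ i, d i * S.conj (d i.rev) = 1) (g : S.GG)
    (i j : Fin 3) : S.mat ((diagG h)⁻¹ * g) i j = S.conj (d i.rev) * S.mat g i j := by
  rw [mat_mul, mat_diagG_inv, Matrix.diagonal_mul]

lemma diagG_comm_alpha {d : Fin 3 → S.E} (h : ∀ i, d i * S.conj (d i.rev) = 1) (n : ℤ) :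
    diagG h * S.alphaE ^ n = S.alphaE ^ n * diagG h := by
  apply mat_ext
  rw [mat_mul, mat_mul, mat_diagG, mat_alpha_zpow, Matrix.diagonal_mul_diagonal,
    Matrix.diagonal_mul_diagonal]
  simp only [mul_comm]

/-- Lower unipotent elements. -/
def IsLowU (g : S.GG) : Prop :=
  S.mat g 0 0 = 1 ∧ S.mat g 1 1 = 1 ∧ S.mat g 2 2 = 1 ∧
    S.mat g 0 1 = 0 ∧ S.mat g 0 2 = 0 ∧ S.mat g 1 2 = 0

/-- Upper unipotent elements. -/
def IsUpU (g : S.GG) : Prop :=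
  S.mat g 0 0 = 1 ∧ S.mat g 1 1 = 1 ∧ S.mat g 2 2 = 1 ∧
    S.mat g 1 0 = 0 ∧ S.mat g 2 0 = 0 ∧ S.mat g 2 1 = 0

lemma isLowU_lowN {x y : S.E} (h : x * S.conj x + y + S.conj y = 0) : IsLowU (lowN h) := by
  simp [IsLowU, mat_lowN, n'M]

/-- Upper triangular elements. -/
def IsUpT (g : S.GG) : Prop := S.mat g 1 0 = 0 ∧ S.mat g 2 0 = 0 ∧ S.mat g 2 1 = 0

lemma isUpT_of_col {g : S.GG} (h1 : S.mat g 1 0 = 0) (h2 : S.mat g 2 0 = 0) : IsUpT g := by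
  have h02 := form_apply g 0 2
  have h01 := form_apply g 0 1
  simp only [h1, h2, zero_mul, add_zero, betaM] at h01 h02
  simp at h01 h02
  refine ⟨h1, h2, ?_⟩
  rcases h01 with h | h
  · simp [h] at h02
  · exact h

lemma IsUpT.diag_form {g : S.GG} (h : IsUpT g) (i : Fin 3) :
    S.mat g i i * S.conj (S.mat g i.rev i.rev) = 1 := by
  obtain ⟨h1, h2, h3⟩ := h
  have h02 := form_apply g 0 2
  have h11 := form_apply g 1 1
  have h20 := form_apply g 2 0
  simp only [h1, h2, h3, zero_mul, add_zero, map_zero, mul_zero, zero_add, betaM] at h02 h11 h20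
  simp at h02 h11 h20
  fin_cases i
  · exact h02
  · exact h11
  · exact h20

end Setting

namespace IsLevel

open Setting

variable {S : Setting} {C : Chamber S} {r : ℤ} (hL : IsLevel C r)

include hL

lemma Iw_le_K {g : S.GG} (hg : g ∈ S.Iw hL.hr) : g ∈ C.K :=
  (hL.mem_K g).2 (MM_mono (eA_le_eI hL.hr) hg)

lemma mem_Iw_of_mem_K {g : S.GG} (hg : g ∈ C.K) (h : S.mat g 2 0 ∈ S.pE (1 + r)) :
    g ∈ S.Iw hL.hr := by
  have hr := hL.hr
  have hK := (hL.mem_K g).1 hg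
  rw [mem_MM_iff] at hK
  simp [eA] at hK
  obtain ⟨⟨h00, h01, h02⟩, ⟨h10, h11, h12⟩, ⟨h20, h21, h22⟩⟩ := hK
  have f0 := form_apply g 0 0
  have f2 := form_apply_row g 2 2
  simp only [betaM] at f0 f2
  simp at f0 f2
  have e10 : S.mat g 1 0 ∈ S.pE 1 := by
    refine mem_pE_of_norm (m := 1 + r) ?_ (by omega)
    rw [show S.mat g 1 0 * S.conj (S.mat g 1 0) =
      -(S.mat g 0 0 * S.conj (S.mat g 2 0) + S.mat g 2 0 * S.conj (S.mat g 0 0)) by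
        linear_combination f0]
    exact pE_neg (pE_add (pE_mul' h00 (conj_mem_pE h) (by omega))
      (pE_mul' h (conj_mem_pE h00) (by omega)))
  have e21 : S.mat g 2 1 ∈ S.pE 1 := by
    refine mem_pE_of_norm (m := 1 + r) ?_ (by omega)
    rw [show S.mat g 2 1 * S.conj (S.mat g 2 1) =
      -(S.mat g 2 2 * S.conj (S.mat g 2 0) + S.mat g 2 0 * S.conj (S.mat g 2 2)) by
        linear_combination f2]
    exact pE_neg (pE_add (pE_mul' h22 (conj_mem_pE h) (by omega))
      (pE_mul' h (conj_mem_pE h22) (by omega)))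
  show S.mat g ∈ S.MM (eI r)
  rw [mem_MM_iff]
  simp [eI]
  tauto

lemma betaK_mul_self : C.βK * C.βK = 1 := by
  rw [hL.beta_eq, mul_assoc, ← mul_assoc _ S.betaE, alpha_zpow_mul_beta, mul_assoc S.betaE,
    ← zpow_add, neg_neg, add_neg_cancel, zpow_zero, mul_one, beta_mul_self]

lemma alpha_zpow_mul_betaK (m : ℤ) : S.alphaE ^ m * C.βK = C.βK * S.alphaE ^ (-m) := by
  rw [hL.beta_eq, ← mul_assoc, alpha_zpow_mul_beta, mul_assoc, mul_assoc, ← zpow_add, ← zpow_add,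
    add_comm]

lemma mat_betaK_mul (g : S.GG) (i j : Fin 3) :
    S.mat (C.βK * g) i j = S.ϖ ^ (-(r * wt i)) * S.mat g i.rev j := by
  rw [hL.beta_eq, mul_assoc, mat_beta_mul_apply, mat_alpha_mul_apply, wt_rev]
  congr 2
  ring

lemma mat_mul_betaK (g : S.GG) (i j : Fin 3) :
    S.mat (g * C.βK) i j = S.mat g i j.rev * S.ϖ ^ (r * wt j) := by
  rw [hL.beta_eq, ← mul_assoc, mat_mul_alpha_apply, mat_mul_beta_apply]
  congr 2
  ring

lemma betaK_mem : C.βK ∈ C.K := by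
  rw [hL.mem_K, ← mul_one C.βK]
  intro i j
  rw [hL.mat_betaK_mul, mat_one]
  have h1 := one_mem_pE (S := S)
  have hp := unif_zpow_mem_pE (S := S) r
  have hn := unif_zpow_mem_pE (S := S) (-r)
  have h0 := pE_zero_mem (S := S)
  fin_cases i <;> fin_cases j <;> simp [wt, eA, Matrix.one_apply, Fin.ext_iff] <;>
    first | exact h1 | simpa using hp | simpa using hn | exact h0 _

lemma alpha_conj_mem {n : S.GG} (hn : n ∈ C.K) (hu : IsLowU n) {m : ℤ} (hm : 0 ≤ m) :
    S.alphaE ^ m * n * S.alphaE ^ (-m) ∈ C.K := by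
  obtain ⟨h1, h2, h3, h4, h5, h6⟩ := hu
  rw [hL.mem_K] at hn ⊢
  intro i j
  rw [mat_mul_alpha_apply, mat_alpha_mul_apply]
  have key : wt j < wt i → S.mat n i j = 0 := by
    fin_cases i <;> fin_cases j <;> simp [wt, h4, h5, h6]
  by_cases h : wt j < wt i
  · rw [key h]
    simpa using pE_zero_mem _
  · refine pE_mul' (k := -(m * wt i) + eA r i j) (pE_mul (unif_zpow_mem_pE _) (hn i j))
      (unif_zpow_mem_pE (-(-m * wt j))) ?_
    push Not at h
    nlinarith

lemma lowN_mem_K {x y : S.E} (h : x * S.conj x + y + S.conj y = 0) (hy : y ∈ S.pE r) :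
    lowN h ∈ C.K := by
  have hr := hL.hr
  have hx : x ∈ S.pE r := by
    refine mem_pE_of_norm (m := r) ?_ (by omega)
    rw [show x * S.conj x = -(y + S.conj y) by linear_combination h]
    exact pE_neg (pE_add hy (conj_mem_pE hy))
  rw [hL.mem_K, mem_MM_iff, mat_lowN]
  simp [eA, n'M]
  exact ⟨⟨one_mem_pE, pE_zero_mem _, pE_zero_mem _⟩, ⟨hx, one_mem_pE, pE_zero_mem _⟩,
    hy, pE_neg (conj_mem_pE hx), one_mem_pE⟩

lemma lowN_mem_Iw {x y : S.E} (h : x * S.conj x + y + S.conj y = 0) (hy : y ∈ S.pE (1 + r)) :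
    lowN h ∈ S.Iw hL.hr :=
  hL.mem_Iw_of_mem_K (hL.lowN_mem_K h (pE_mono (by omega) hy)) (by simpa [mat_lowN, n'M] using hy)

/-- An element whose first column is dominated by its first entry becomes upper triangular after
multiplication by a lower unipotent. -/
lemma exists_lowN_inv_mul_isUpT {g : S.GG} (h0 : S.mat g 0 0 ≠ 0)
    (h2 : S.mat g 2 0 / S.mat g 0 0 ∈ S.pE r) :
    ∃ n ∈ C.K, IsLowU n ∧ IsUpT (n⁻¹ * g) := by
  have f := form_apply g 0 0
  simp only [betaM] at f
  simp at f
  set a := S.mat g 0 0 with ha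
  set b := S.mat g 1 0 with hb
  set c := S.mat g 2 0 with hc
  have ha' : S.conj a ≠ 0 := by simpa using h0
  have h : (b / a) * S.conj (b / a) + c / a + S.conj (c / a) = 0 := by
    rw [map_div₀, map_div₀]
    field_simp
    linear_combination f
  refine ⟨lowN h, hL.lowN_mem_K h h2, isLowU_lowN h, isUpT_of_col ?_ ?_⟩
  · rw [mat_mul, Matrix.mul_apply, Fin.sum_univ_three, mat_inv_apply, mat_inv_apply, mat_inv_apply,
      ← ha, ← hb, ← hc, mat_lowN]
    simp [n'M, S.conj_invol]
    field_simp
    ring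
  · rw [mat_mul, Matrix.mul_apply, Fin.sum_univ_three, mat_inv_apply, mat_inv_apply, mat_inv_apply,
      ← ha, ← hb, ← hc, mat_lowN]
    simp [n'M]
    field_simp
    linear_combination f

lemma K_decomp {k : S.GG} (hk : k ∈ C.K) :
    (∃ n ∈ C.K, IsLowU n ∧ ∃ i ∈ S.Iw hL.hr, k = n * i) ∨ ∃ i ∈ S.Iw hL.hr, k = C.βK * i := by
  have hK := (hL.mem_K k).1 hk
  by_cases h : S.mat k 0 0 ∈ S.pE 1
  · right
    refine ⟨C.βK * k, ?_, by rw [← mul_assoc, hL.betaK_mul_self, one_mul]⟩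
    refine hL.mem_Iw_of_mem_K (C.K.mul_mem hL.betaK_mem hk) ?_
    rw [hL.mat_betaK_mul]
    exact pE_mul' (unif_zpow_mem_pE _) h (by simp [wt]; omega)
  · left
    have hu : S.IsU (S.mat k 0 0) := isU_of_not_mem (mem_pE_zero.1 (hK 0 0)) h
    obtain ⟨n, hn, hl, hup⟩ := hL.exists_lowN_inv_mul_isUpT hu.2.2 (by
      rw [div_eq_mul_inv]
      exact pE_mul' (hK 2 0) (mem_pE_zero.2 hu.2.1) (by simp [eA]))
    refine ⟨n, hn, hl, n⁻¹ * k, ?_, by group⟩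
    refine hL.mem_Iw_of_mem_K (C.K.mul_mem (C.K.inv_mem hn) hk) ?_
    rw [hup.2.1]
    exact pE_zero_mem _

lemma exists_mul_isUpT (g : S.GG) : ∃ k ∈ C.K, IsUpT (k * g) := by
  have hr := hL.hr
  by_cases h : S.mat g 0 0 ≠ 0 ∧ S.mat g 2 0 / S.mat g 0 0 ∈ S.pE r
  · obtain ⟨n, hn, -, hup⟩ := hL.exists_lowN_inv_mul_isUpT h.1 h.2
    exact ⟨n⁻¹, C.K.inv_mem hn, hup⟩
  have key : S.mat g 2 0 ≠ 0 ∧ S.mat g 0 0 / S.mat g 2 0 ∈ S.pE (-r) := by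
    by_cases h0 : S.mat g 0 0 = 0
    · rw [h0]
      refine ⟨fun h2 => ?_, by simpa using pE_zero_mem _⟩
      have f := form_apply g 0 0
      have f' := form_apply g 0 2
      simp only [betaM] at f f'
      simp [h0, h2] at f f'
      simp [f] at f'
    · have hy : S.mat g 2 0 / S.mat g 0 0 ∉ S.pE r := fun h2 => h ⟨h0, h2⟩
      have h2 : S.mat g 2 0 ≠ 0 := fun h2 => hy (by simpa [h2] using pE_zero_mem _)
      refine ⟨h2, ?_⟩
      obtain ⟨n, u, hu, e⟩ := exists_unit_mul_zpow (div_ne_zero h2 h0)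
      rw [e, hu.mul_zpow_mem_pE_iff] at hy
      rw [← inv_div, e, mul_inv, ← zpow_neg, hu.inv.mul_zpow_mem_pE_iff]
      omega
  have e0 : S.mat (C.βK * g) 0 0 = S.ϖ ^ (-r) * S.mat g 2 0 := by
    rw [hL.mat_betaK_mul]
    simp [wt]
  have e2 : S.mat (C.βK * g) 2 0 = S.ϖ ^ r * S.mat g 0 0 := by
    rw [hL.mat_betaK_mul]
    simp [wt]
  obtain ⟨n, hn, -, hup⟩ := hL.exists_lowN_inv_mul_isUpT (g := C.βK * g) (by
      rw [e0]
      exact mul_ne_zero (zpow_ne_zero _ S.unif_ne) key.1) (by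
      rw [e0, e2, mul_div_mul_comm, ← zpow_sub₀ S.unif_ne]
      exact pE_mul' (unif_zpow_mem_pE _) key.2 (by omega))
  refine ⟨n⁻¹ * C.βK, C.K.mul_mem (C.K.inv_mem hn) hL.betaK_mem, ?_⟩
  rwa [mul_assoc]

lemma upU_mem_Iw {n : S.GG} (hu : IsUpU n) (h : S.mat n 0 2 ∈ S.pE (-r)) : n ∈ S.Iw hL.hr := by
  have hr := hL.hr
  obtain ⟨h1, h2, h3, h4, h5, h6⟩ := hu
  have f := form_apply_row n 0 0
  have f' := form_apply n 2 2
  simp only [betaM] at f f'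
  simp [h1, h3] at f f'
  have e1 : S.mat n 0 1 ∈ S.pE 0 := by
    refine mem_pE_of_norm (m := -r) ?_ (by omega)
    rw [show S.mat n 0 1 * S.conj (S.mat n 0 1) = -(S.conj (S.mat n 0 2) + S.mat n 0 2) by
      linear_combination f]
    exact pE_neg (pE_add (conj_mem_pE h) h)
  have e2 : S.mat n 1 2 ∈ S.pE 0 := by
    refine mem_pE_of_norm (m := -r) ?_ (by omega)
    rw [show S.mat n 1 2 * S.conj (S.mat n 1 2) = -(S.conj (S.mat n 0 2) + S.mat n 0 2) by
      linear_combination f']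
    exact pE_neg (pE_add (conj_mem_pE h) h)
  show S.mat n ∈ S.MM (eI r)
  rw [mem_MM_iff, h1, h2, h3, h4, h5, h6]
  simp [eI, e1, e2, h, pE_zero_mem, one_mem_pE]

lemma upU_mem_I1 {n : S.GG} (hu : IsUpU n) (h : S.mat n 0 2 ∈ S.pE (-r)) : n ∈ C.I1 := by
  refine (hL.mem_I1 n).2 ⟨hL.upU_mem_Iw hu h, ?_⟩
  obtain ⟨h1, h2, h3, -⟩ := hu
  simp [h1, h2, h3, pE_zero_mem]

lemma isUpU_betaK_conj {n : S.GG} (hu : IsLowU n) : IsUpU (C.βK * n * C.βK) := by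
  obtain ⟨h1, h2, h3, h4, h5, h6⟩ := hu
  have hz : S.ϖ ^ r ≠ 0 := zpow_ne_zero _ S.unif_ne
  refine ⟨?_, ?_, ?_, ?_, ?_, ?_⟩ <;> rw [hL.mat_mul_betaK, hL.mat_betaK_mul] <;>
    simp [wt, h1, h2, h3, h4, h5, h6, hz]

lemma betaK_conj_mem_I1 {n : S.GG} (hn : n ∈ C.K) (hu : IsLowU n) : C.βK * n * C.βK ∈ C.I1 := by
  have hK := (hL.mem_K _).1 (C.K.mul_mem (C.K.mul_mem hL.betaK_mem hn) hL.betaK_mem)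
  exact hL.upU_mem_I1 (hL.isUpU_betaK_conj hu) (hK 0 2)

end IsLevel

namespace IsLevel

open Setting

variable {S : Setting} {C : Chamber S} {r : ℤ} (hL : IsLevel C r)

/-- Elements of `K α^ℤ I`. -/
def Cov (g : S.GG) : Prop :=
  ∃ k ∈ C.K, ∃ n : ℤ, ∃ i ∈ S.Iw hL.hr, g = k * S.alphaE ^ n * i

include hL

lemma cov_mul_left {k g : S.GG} (hk : k ∈ C.K) (h : hL.Cov g) : hL.Cov (k * g) := by
  obtain ⟨k', hk', n, i, hi, rfl⟩ := h
  exact ⟨k * k', C.K.mul_mem hk hk', n, i, hi, by simp only [mul_assoc]⟩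

lemma cov_of_mul_left {k g : S.GG} (hk : k ∈ C.K) (h : hL.Cov (k * g)) : hL.Cov g := by
  simpa using hL.cov_mul_left (C.K.inv_mem hk) h

lemma cov_of_mul_right {i g : S.GG} (hi : i ∈ S.Iw hL.hr) (h : hL.Cov (g * i)) : hL.Cov g := by
  obtain ⟨k', hk', n, j, hj, e⟩ := h
  exact ⟨k', hk', n, j * i⁻¹, Subgroup.mul_mem _ hj (Subgroup.inv_mem _ hi), by
    rw [← mul_assoc, ← e, mul_inv_cancel_right]⟩

/-- An upper triangular element is, up to `K`, a power of `α` times a unipotent. -/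
lemma upT_decomp {g : S.GG} (hg : IsUpT g) {u : S.E} (hu : S.IsU u) {s : ℤ}
    (h0 : S.mat g 0 0 = u * S.ϖ ^ (-s)) :
    ∃ k ∈ C.K, ∃ n, IsUpU n ∧ S.mat n 0 2 * S.mat g 0 0 = S.mat g 0 2 ∧
      g = k * S.alphaE ^ s * n := by
  have hd := hg.diag_form
  have hb : S.IsU (S.mat g 1 1) := isU_of_norm_eq_one (hd 1)
  have ht : ∀ i, (![u, S.mat g 1 1, (S.conj u)⁻¹] : Fin 3 → S.E) i *
      S.conj ((![u, S.mat g 1 1, (S.conj u)⁻¹] : Fin 3 → S.E) i.rev) = 1 := by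
    intro i
    have h1 := hd 1
    have hu0 := hu.2.2
    have hu1 := hu.conj.2.2
    fin_cases i
    · simp [S.conj_invol, hu0]
    · exact h1
    · simp [hu1]
  have hz := zpow_ne_zero s S.unif_ne
  have h2 : S.mat g 2 2 = (S.conj u)⁻¹ * S.ϖ ^ s := by
    have h20 := hd 2
    have e : (2 : Fin 3).rev = 0 := rfl
    have hu1 := hu.conj.2.2
    rw [e, h0, map_mul, map_zpow₀, S.unif_conj, zpow_neg] at h20
    field_simp at h20 ⊢
    exact h20
  have hD : diagG hd = diagG ht * S.alphaE ^ s := by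
    apply mat_ext
    rw [mat_mul, mat_diagG, mat_diagG, mat_alpha_zpow, Matrix.diagonal_mul_diagonal]
    congr 1
    funext i
    fin_cases i
    · simpa [wt] using h0
    · simp [wt]
    · simpa [wt] using h2
  refine ⟨diagG ht, ?_, (diagG hd)⁻¹ * g, ?_, ?_, ?_⟩
  · rw [hL.mem_K, mem_MM_iff, mat_diagG]
    simp [eA, pE_zero_mem, mem_pE_zero, hu.1, hb.1, hu.conj.2.1]
  · obtain ⟨h1, h2, h3⟩ := hg
    refine ⟨?_, ?_, ?_, ?_, ?_, ?_⟩ <;> rw [diagG_inv_mul_apply]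
    · rw [mul_comm, hd]
    · rw [mul_comm, hd]
    · rw [mul_comm, hd]
    · rw [h1, mul_zero]
    · rw [h2, mul_zero]
    · rw [h3, mul_zero]
  · rw [diagG_inv_mul_apply]
    have := hd 0
    linear_combination S.mat g 0 2 * this
  · rw [← hD, mul_inv_cancel_left]

lemma cov_of_upU {n : S.GG} (hn : IsUpU n) {s : ℤ}
    (h : S.mat n 0 2 ∈ S.pE (-r) ∨ S.mat n 0 2 ∈ S.pE (2 * s - r)) :
    hL.Cov (S.alphaE ^ s * n) := by
  rcases h with h | h
  · exact ⟨1, C.K.one_mem, s, n, hL.upU_mem_Iw hn h, by simp⟩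
  · refine ⟨S.alphaE ^ s * n * S.alphaE ^ (-s), ?_, s, 1, Subgroup.one_mem _, by simp⟩
    apply hL.Iw_le_K
    refine hL.upU_mem_Iw ?_ ?_
    · obtain ⟨h1, h2, h3, h4, h5, h6⟩ := hn
      have hz : S.ϖ ^ s ≠ 0 := zpow_ne_zero _ S.unif_ne
      refine ⟨?_, ?_, ?_, ?_, ?_, ?_⟩ <;> rw [mat_mul_alpha_apply, mat_alpha_mul_apply] <;>
        simp [wt, h1, h2, h3, h4, h5, h6, hz]
    · rw [mat_mul_alpha_apply, mat_alpha_mul_apply]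
      exact pE_mul' (pE_mul (unif_zpow_mem_pE _) h) (unif_zpow_mem_pE _) (by simp [wt]; omega)

lemma exists_cov (g : S.GG) : hL.Cov g := by
  have hr := hL.hr
  obtain ⟨k, hk, hup⟩ := hL.exists_mul_isUpT g
  apply hL.cov_of_mul_left hk
  have h0 : S.mat (k * g) 0 0 ≠ 0 := left_ne_zero_of_mul_eq_one (hup.diag_form 0)
  obtain ⟨s', u, hu, e⟩ := exists_unit_mul_zpow h0
  obtain ⟨s, rfl⟩ : ∃ s, s' = -s := ⟨-s', by simp⟩
  obtain ⟨k', hk', n, hn, -, e'⟩ := hL.upT_decomp hup hu e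
  rw [e', mul_assoc]
  apply hL.cov_mul_left hk'
  by_cases h1 : S.mat n 0 2 ∈ S.pE (-r)
  · exact hL.cov_of_upU hn (Or.inl h1)
  by_cases h2 : S.mat n 0 2 ∈ S.pE (2 * s - r)
  · exact hL.cov_of_upU hn (Or.inr h2)
  obtain ⟨a1, a2, a3, a4, a5, a6⟩ := hn
  have f := form_apply_row n 0 0
  have f' := form_apply n 1 2
  have f'' := form_apply n 2 2
  simp only [betaM] at f f' f''
  simp [a1, a2, a3, a6] at f f' f''
  have hz : S.mat n 1 2 = -S.conj (S.mat n 0 1) := by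
    have := congrArg S.conj f'
    simp [S.conj_invol] at this
    linear_combination this
  set x := S.mat n 0 1 with hx
  set y := S.mat n 0 2 with hy
  have hy0 : y ≠ 0 := fun h => h1 (by rw [h]; exact pE_zero_mem _)
  have hyc : S.conj y ≠ 0 := by simpa using hy0
  obtain ⟨l, v, hv, ey⟩ := exists_unit_mul_zpow hy0
  have hl1 : l < -r := by
    by_contra! hlt
    exact h1 (by rw [ey, hv.mul_zpow_mem_pE_iff]; exact hlt)
  have hl2 : l < 2 * s - r := by
    by_contra! hlt
    exact h2 (by rw [ey, hv.mul_zpow_mem_pE_iff]; exact hlt)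
  have hform : (S.conj x / S.conj y) * S.conj (S.conj x / S.conj y) + 1 / S.conj y +
      S.conj (1 / S.conj y) = 0 := by
    simp only [map_div₀, S.conj_invol, map_one]
    field_simp
    linear_combination f
  have eyc : S.conj y = S.conj v * S.ϖ ^ l := by rw [ey, map_mul, map_zpow₀, S.unif_conj]
  have hYv : 1 / S.conj y = (S.conj v)⁻¹ * S.ϖ ^ (-l) := by
    rw [eyc, one_div, mul_inv, zpow_neg]
  have hI : lowN hform ∈ S.Iw hL.hr := by
    apply hL.lowN_mem_Iw
    rw [hYv, hv.conj.inv.mul_zpow_mem_pE_iff]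
    omega
  apply hL.cov_of_mul_right hI
  rw [mul_assoc]
  apply hL.cov_of_mul_left hL.betaK_mem
  have ent : ∀ i j, S.mat (C.βK * (S.alphaE ^ s * (n * lowN hform))) i j =
      S.ϖ ^ (-(r * wt i)) * (S.ϖ ^ (-(s * wt i.rev)) * S.mat (n * lowN hform) i.rev j) := by
    intro i j
    rw [hL.mat_betaK_mul, mat_alpha_mul_apply]
  set g3 := C.βK * (S.alphaE ^ s * (n * lowN hform)) with hg3
  have r0 : (0 : Fin 3).rev = 2 := rfl
  have r1 : (1 : Fin 3).rev = 1 := rfl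
  have r2 : (2 : Fin 3).rev = 0 := rfl
  have m00 : S.mat (n * lowN hform) 0 0 = 0 := by
    rw [mat_mul, Matrix.mul_apply, Fin.sum_univ_three, mat_lowN, a1, ← hx, ← hy]
    simp [n'M]
    field_simp
    linear_combination f
  have m10 : S.mat (n * lowN hform) 1 0 = 0 := by
    rw [mat_mul, Matrix.mul_apply, Fin.sum_univ_three, mat_lowN, a2, a4, hz]
    simp [n'M]
    ring
  have m20 : S.mat (n * lowN hform) 2 0 = 1 / S.conj y := by
    rw [mat_mul, Matrix.mul_apply, Fin.sum_univ_three, mat_lowN, a3, a5, a6]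
    simp [n'M]
  have m22 : S.mat (n * lowN hform) 2 2 = 1 := by
    rw [mat_mul, Matrix.mul_apply, Fin.sum_univ_three, mat_lowN, a3, a5, a6]
    simp [n'M]
  have up3 : IsUpT g3 := by
    apply isUpT_of_col
    · rw [ent, r1, m10]
      simp
    · rw [ent, r2, m00]
      simp
  have e00 : S.mat g3 0 0 = (S.conj v)⁻¹ * S.ϖ ^ (-(l + r - s)) := by
    have hw : ∀ (a b c : ℤ) (w : S.E),
        S.ϖ ^ a * (S.ϖ ^ b * (w * S.ϖ ^ c)) = w * S.ϖ ^ (a + b + c) := by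
      intro a b c w
      rw [zpow_add₀ S.unif_ne, zpow_add₀ S.unif_ne]
      ring
    rw [ent, r0, m20, hYv, hw]
    congr 2
    simp [wt]
    ring
  obtain ⟨k3, hk3, n3, hn3, e3, eg3⟩ := hL.upT_decomp up3 hv.conj.inv e00
  rw [eg3, mul_assoc]
  apply hL.cov_mul_left hk3
  apply hL.cov_of_upU hn3
  right
  have : S.mat n3 0 2 = S.conj y := by
    have hne : S.mat g3 0 0 ≠ 0 := left_ne_zero_of_mul_eq_one (up3.diag_form 0)
    apply mul_right_cancel₀ hne
    rw [e3, ent, ent, r0, m22, m20]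
    field_simp
  rw [this, eyc, hv.conj.mul_zpow_mem_pE_iff]
  omega

lemma Iw_entries {i : S.GG} (hi : i ∈ S.Iw hL.hr) :
    (S.mat i 0 0 ∈ S.pE 0 ∧ S.mat i 0 1 ∈ S.pE 0 ∧ S.mat i 0 2 ∈ S.pE (-r)) ∧
    (S.mat i 1 0 ∈ S.pE 1 ∧ S.mat i 1 1 ∈ S.pE 0 ∧ S.mat i 1 2 ∈ S.pE 0) ∧
    (S.mat i 2 0 ∈ S.pE (1 + r) ∧ S.mat i 2 1 ∈ S.pE 1 ∧ S.mat i 2 2 ∈ S.pE 0) := by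
  have h : S.mat i ∈ S.MM (eI r) := hi
  rw [mem_MM_iff] at h
  simpa [eI] using h

lemma Iw_diag {i : S.GG} (hi : i ∈ S.Iw hL.hr) :
    S.mat i 0 0 * S.conj (S.mat i 2 2) - 1 ∈ S.pE 1 ∧
    S.mat i 1 1 * S.conj (S.mat i 1 1) - 1 ∈ S.pE 1 := by
  obtain ⟨⟨h00, h01, h02⟩, ⟨h10, h11, h12⟩, ⟨h20, h21, h22⟩⟩ := hL.Iw_entries hi
  have f := form_apply i 0 2
  have f' := form_apply i 1 1
  simp only [betaM] at f f'
  simp at f f'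
  constructor
  · rw [show S.mat i 0 0 * S.conj (S.mat i 2 2) - 1 = -(S.mat i 1 0 * S.conj (S.mat i 1 2) +
      S.mat i 2 0 * S.conj (S.mat i 0 2)) by linear_combination f]
    exact pE_neg (pE_add (pE_mul' h10 (conj_mem_pE h12) (by omega))
      (pE_mul' h20 (conj_mem_pE h02) (by omega)))
  · rw [show S.mat i 1 1 * S.conj (S.mat i 1 1) - 1 = -(S.mat i 0 1 * S.conj (S.mat i 2 1) +
      S.mat i 2 1 * S.conj (S.mat i 0 1)) by linear_combination f']
    exact pE_neg (pE_add (pE_mul' h01 (conj_mem_pE h21) (by omega))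
      (pE_mul' h21 (conj_mem_pE h01) (by omega)))

lemma Iw_diag_isU {i : S.GG} (hi : i ∈ S.Iw hL.hr) :
    S.IsU (S.mat i 0 0) ∧ S.IsU (S.mat i 1 1) ∧ S.IsU (S.mat i 2 2) := by
  obtain ⟨⟨h00, h01, h02⟩, ⟨h10, h11, h12⟩, ⟨h20, h21, h22⟩⟩ := hL.Iw_entries hi
  obtain ⟨d0, d1⟩ := hL.Iw_diag hi
  rw [mem_pE_zero] at h00 h11 h22
  refine ⟨isU_of_mul_sub_one h00 (S.conj_O _ h22) d0, isU_of_mul_sub_one h11 (S.conj_O _ h11) d1,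
    isU_of_mul_sub_one h22 (S.conj_O _ h00) ?_⟩
  have := conj_mem_pE d0
  rw [map_sub, map_mul, S.conj_invol, map_one] at this
  rwa [mul_comm]

lemma alpha_zpow_inj {n m : ℤ} {i : S.GG} (hi : i ∈ S.Iw hL.hr)
    (h : S.alphaE ^ n * i * S.alphaE ^ (-m) ∈ C.K) : n = m := by
  obtain ⟨u0, -, u2⟩ := hL.Iw_diag_isU hi
  have hK := (hL.mem_K _).1 h
  have k0 := hK 0 0
  have k2 := hK 2 2
  rw [mat_mul_alpha_apply, mat_alpha_mul_apply, mul_comm, ← mul_assoc, ← zpow_add₀ S.unif_ne,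
    mul_comm, IsU.mul_zpow_mem_pE_iff ‹_›] at k0 k2
  simp [eA, wt] at k0 k2
  omega

lemma Kone_le_Iw {z : S.GG} (hz : z ∈ C.KoneS) : z ∈ S.Iw hL.hr := by
  have h := MM_add (MM_mono (eI_le_eJ hL.hr) ((hL.mem_Kone z).1 hz))
    (MM_one (S := S) (eI_diag r))
  rwa [sub_add_cancel] at h

lemma Kone_normal {z k : S.GG} (hz : z ∈ C.KoneS) (hk : k ∈ C.K) : k * z * k⁻¹ ∈ C.KoneS := by
  have hz' := (hL.mem_Kone z).1 hz
  have hk' := (hL.mem_K k).1 hk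
  have hk'' := (hL.mem_K k⁻¹).1 (C.K.inv_mem hk)
  rw [hL.mem_Kone]
  have e : S.mat (k * z * k⁻¹) - 1 = S.mat k * (S.mat z - 1) * S.mat k⁻¹ := by
    rw [mul_sub, sub_mul, mul_one, ← mat_mul, ← mat_mul, ← mat_mul, mul_inv_cancel, mat_one]
  rw [e]
  exact MM_mul (eJ_eA hL.hr) (MM_mul (eA_eJ hL.hr) hk' hz') hk''

/-- `I = H₀ I₁`, with the factor in `H₀` commuting with `α`. -/
lemma Iw_decomp {i : S.GG} (hi : i ∈ S.Iw hL.hr) :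
    ∃ h ∈ C.H0, (∀ n : ℤ, h * S.alphaE ^ n = S.alphaE ^ n * h) ∧ h ∈ C.K ∧
      ∃ j ∈ C.I1, i = h * j := by
  obtain ⟨⟨h00, h01, h02⟩, ⟨h10, h11, h12⟩, ⟨h20, h21, h22⟩⟩ := hL.Iw_entries hi
  obtain ⟨d0, d1⟩ := hL.Iw_diag hi
  obtain ⟨u0, u1, u2⟩ := hL.Iw_diag_isU hi
  have hr := hL.hr
  set δ := (S.mat i).det with hδ
  have hdet : δ * S.conj δ = 1 := by
    have := congrArg Matrix.det (form_eq i)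
    rw [Matrix.det_mul, Matrix.det_mul, Matrix.det_transpose, ← RingHom.mapMatrix_apply,
      ← RingHom.map_det] at this
    have hb : S.betaM.det ≠ 0 := by
      intro h0
      have h1 := congrArg Matrix.det S.beta_mul_beta
      rw [Matrix.det_mul, h0, zero_mul, Matrix.det_one] at h1
      exact zero_ne_one h1
    apply mul_right_cancel₀ hb
    rw [one_mul]
    linear_combination this
  have hδu := isU_of_norm_eq_one hdet
  have hδ' : δ - S.mat i 0 0 * S.mat i 1 1 * S.mat i 2 2 ∈ S.pE 1 := by
    have e : δ - S.mat i 0 0 * S.mat i 1 1 * S.mat i 2 2 =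
        S.mat i 1 2 * S.mat i 2 1 * (-S.mat i 0 0) + S.mat i 1 0 * S.mat i 2 2 * (-S.mat i 0 1) +
        S.mat i 2 0 * S.mat i 0 1 * S.mat i 1 2 + S.mat i 2 1 * S.mat i 0 2 * S.mat i 1 0 +
        S.mat i 2 0 * S.mat i 0 2 * (-S.mat i 1 1) := by
      rw [hδ, Matrix.det_fin_three]
      ring
    rw [e]
    refine pE_add (pE_add (pE_add (pE_add ?_ ?_) ?_) ?_) ?_
    · exact pE_mul' (pE_mul h12 h21) (pE_neg h00) (by omega)
    · exact pE_mul' (pE_mul h10 h22) (pE_neg h01) (by omega)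
    · exact pE_mul' (pE_mul h20 h01) h12 (by omega)
    · exact pE_mul' (pE_mul h21 h02) h10 (by omega)
    · exact pE_mul' (pE_mul h20 h02) (pE_neg h11) (by omega)
  set a := S.mat i 0 0 with ha
  set e := S.mat i 1 1 with he
  set c := S.mat i 2 2 with hc
  have ha0 := u0.2.2
  have hac0 := u0.conj.2.2
  have ht : ∀ j, (![a, δ * S.conj a * a⁻¹, (S.conj a)⁻¹] : Fin 3 → S.E) j *
      S.conj ((![a, δ * S.conj a * a⁻¹, (S.conj a)⁻¹] : Fin 3 → S.E) j.rev) = 1 := by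
    intro j
    fin_cases j
    · simp [S.conj_invol, ha0]
    · simp [S.conj_invol]
      field_simp
      exact hdet
    · simp [hac0]
  have hH : diagG ht ∈ S.Iw hL.hr := by
    show S.mat (diagG ht) ∈ S.MM (eI r)
    rw [mem_MM_iff, mat_diagG]
    simp [eI, pE_zero_mem, mem_pE_zero, u0.1, ((hδu.mul u0.conj).mul u0.inv).1, u0.conj.2.1]
  refine ⟨diagG ht, ⟨?_, (hL.mem_IK _).2 hH⟩, diagG_comm_alpha ht, hL.Iw_le_K hH,
    (diagG ht)⁻¹ * i, ?_, by group⟩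
  · refine ⟨a, δ * S.conj a * a⁻¹, (S.conj a)⁻¹, ?_⟩
    rw [mat_diagG]
    ext j k
    fin_cases j <;> fin_cases k <;> simp
  · refine (hL.mem_I1 _).2 ⟨Subgroup.mul_mem _ (Subgroup.inv_mem _ hH) hi, ?_, ?_, ?_⟩ <;>
      rw [diagG_inv_mul_apply]
    · rw [← ha]
      simp [S.conj_invol, ha0, pE_zero_mem]
    · rw [← he]
      simp [S.conj_invol, show (1 : Fin 3).rev = 1 from rfl]
      have hx : S.conj δ * a * (S.conj a)⁻¹ * e - 1 =
          S.conj (δ - a * e * c) * (a * (S.conj a)⁻¹ * e) + (e * S.conj e * (a * S.conj c - 1) +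
            (e * S.conj e - 1)) := by
        simp only [map_sub, map_mul]
        field_simp
        ring
      rw [hx]
      refine pE_add (pE_mul' (conj_mem_pE hδ')
        (mem_pE_zero.2 ((u0.mul u0.conj.inv).mul u1).1) (by omega)) (pE_add ?_ d1)
      exact pE_mul' (pE_mul h11 (conj_mem_pE h11)) d0 (by omega)
    · rw [← hc]
      simp [show (2 : Fin 3).rev = 0 from rfl]
      have := conj_mem_pE d0
      rwa [map_sub, map_mul, S.conj_invol, map_one] at this

end IsLevel

namespace IsLevel

open Setting

variable {S : Setting} {C : Chamber S} {r : ℤ} (hL : IsLevel C r)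

lemma lowN_zero_pow {S : Setting} {y : S.E} (h : 0 * S.conj 0 + y + S.conj y = 0) (k : ℕ) :
    S.mat (lowN h ^ k) = S.n'M 0 (k * y) := by
  induction k with
  | zero =>
    rw [pow_zero, mat_one]
    ext i j
    fin_cases i <;> fin_cases j <;> simp [n'M]
  | succ k ih =>
    rw [pow_succ, mat_mul, ih, mat_lowN]
    ext i j
    fin_cases i <;> fin_cases j <;> simp [n'M, Matrix.mul_apply, Fin.sum_univ_three]
    ring

/-- The Iwahori subgroup as a subgroup of `K`. -/
def II : Subgroup C.K := (S.Iw hL.hr).subgroupOf C.K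

include hL

lemma mem_II {k : C.K} : k ∈ hL.II ↔ (k : S.GG) ∈ S.Iw hL.hr := Subgroup.mem_subgroupOf

lemma I1_le_Iw {g : S.GG} (hg : g ∈ C.I1) : g ∈ S.Iw hL.hr := ((hL.mem_I1 g).1 hg).1

lemma H0_le_Iw {g : S.GG} (hg : g ∈ C.H0) : g ∈ S.Iw hL.hr := (hL.mem_IK g).1 hg.2

lemma K_decomp_left {k : S.GG} (hk : k ∈ C.K) :
    k ∈ S.Iw hL.hr ∨ ∃ i ∈ S.Iw hL.hr, ∃ u ∈ C.I1, k = i * C.βK * u := by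
  have hb := hL.betaK_mul_self
  have hbi : C.βK⁻¹ = C.βK := inv_eq_of_mul_eq_one_left hb
  obtain ⟨n, hn, hu, i, hi, e⟩ | ⟨i, hi, e⟩ :=
    hL.K_decomp (C.K.mul_mem hL.betaK_mem (C.K.inv_mem hk))
  · right
    have hk1 : k = i⁻¹ * n⁻¹ * C.βK := by
      rw [← mul_inv_rev, ← e, mul_inv_rev, inv_inv, hbi, mul_assoc, hb, mul_one]
    have hn' : IsLowU n⁻¹ := by
      obtain ⟨h1, h2, h3, h4, h5, h6⟩ := hu
      have r0 : (0 : Fin 3).rev = 2 := rfl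
      have r1 : (1 : Fin 3).rev = 1 := rfl
      have r2 : (2 : Fin 3).rev = 0 := rfl
      refine ⟨?_, ?_, ?_, ?_, ?_, ?_⟩ <;> rw [mat_inv_apply] <;>
        simp only [r0, r1, r2, h1, h2, h3, h4, h5, h6, map_one, map_zero]
    refine ⟨i⁻¹, Subgroup.inv_mem _ hi, C.βK * n⁻¹ * C.βK,
      hL.betaK_conj_mem_I1 (C.K.inv_mem hn) hn', ?_⟩
    rw [hk1]
    simp only [mul_assoc]
    rw [← mul_assoc C.βK C.βK, hb, one_mul]
  · left
    have : k⁻¹ = i := mul_left_cancel e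
    rw [← inv_inv k, this]
    exact Subgroup.inv_mem _ hi

lemma inv_mul_mem_Iw {k₁ k₂ : S.GG} (h1 : k₁ ∈ C.K) (h2 : k₂ ∈ C.K)
    (e0 : S.mat k₂ 0 0 - S.mat k₁ 0 0 ∈ S.pE 1) (e1 : S.mat k₂ 1 0 - S.mat k₁ 1 0 ∈ S.pE 1)
    (e2 : S.mat k₂ 2 0 - S.mat k₁ 2 0 ∈ S.pE (1 + r)) : k₁⁻¹ * k₂ ∈ S.Iw hL.hr := by
  have hr := hL.hr
  refine hL.mem_Iw_of_mem_K (C.K.mul_mem (C.K.inv_mem h1) h2) ?_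
  have hK := (hL.mem_K _).1 (C.K.inv_mem h1)
  have a0 := hK 2 0
  have a1 := hK 2 1
  have a2 := hK 2 2
  have key : S.mat (k₁⁻¹ * k₂) 2 0 = S.mat k₁⁻¹ 2 0 * (S.mat k₂ 0 0 - S.mat k₁ 0 0) +
      S.mat k₁⁻¹ 2 1 * (S.mat k₂ 1 0 - S.mat k₁ 1 0) +
      S.mat k₁⁻¹ 2 2 * (S.mat k₂ 2 0 - S.mat k₁ 2 0) := by
    have h : S.mat (k₁⁻¹ * k₁) 2 0 = 0 := by
      rw [inv_mul_cancel, mat_one]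
      rfl
    rw [mat_mul, Matrix.mul_apply, Fin.sum_univ_three] at h ⊢
    linear_combination h
  rw [key]
  simp [eA] at a0 a1 a2
  exact pE_add (pE_add (pE_mul' a0 e0 (by omega)) (pE_mul' a1 e1 (by omega)))
    (pE_mul' a2 e2 (by omega))

lemma finite_quot : Finite (C.K ⧸ hL.II) := by
  have hr := hL.hr
  have m0 : ∀ k : C.K, S.mat k 0 0 ∈ S.O := fun k =>
    mem_pE_zero.1 ((hL.mem_K k).1 k.2 0 0)
  have m1 : ∀ k : C.K, S.mat k 1 0 ∈ S.O := fun k => by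
    have := (hL.mem_K k).1 k.2 1 0
    refine mem_pE_zero.1 (pE_mono ?_ this)
    simp [eA]
    omega
  have m2 : ∀ k : C.K, S.ϖ ^ (-r) * S.mat k 2 0 ∈ S.O := fun k =>
    mem_pE_zero.1 (pE_mul' (unif_zpow_mem_pE _) ((hL.mem_K k).1 k.2 2 0) (by simp [eA]))
  let F : (C.K ⧸ hL.II) → (S.O ⧸ S.mI) × (S.O ⧸ S.mI) × (S.O ⧸ S.mI) := fun x =>
    (Ideal.Quotient.mk S.mI ⟨_, m0 x.out⟩, Ideal.Quotient.mk S.mI ⟨_, m1 x.out⟩,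
      Ideal.Quotient.mk S.mI ⟨_, m2 x.out⟩)
  refine Finite.of_injective F fun x y hxy => ?_
  simp only [F, Prod.mk.injEq, mk_eq_iff] at hxy
  obtain ⟨h0, h1, h2⟩ := hxy
  rw [← Quotient.out_eq x, ← Quotient.out_eq y]
  refine Eq.symm (QuotientGroup.eq.2 ?_)
  rw [mem_II]
  refine hL.inv_mul_mem_Iw y.out.2 x.out.2 h0 h1 ?_
  have := pE_mul (unif_zpow_mem_pE (S := S) r) h2
  rw [← mul_sub, ← mul_assoc, ← zpow_add₀ S.unif_ne, add_neg_cancel, zpow_zero, one_mul,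
    add_comm] at this
  exact this

/-- The number of points of `Γ_K / 𝔹` is congruent to `1` modulo `p`. -/
lemma card_quot_modEq : Nat.card (C.K ⧸ hL.II) ≡ 1 [MOD S.p] := by
  have := hL.finite_quot
  have : Fintype (C.K ⧸ hL.II) := Fintype.ofFinite _
  have : Fact S.p.Prime := ⟨S.hp⟩
  obtain ⟨u, hu, htr⟩ := exists_isU_trace_zero S
  have hy : 0 * S.conj 0 + u * S.ϖ ^ r + S.conj (u * S.ϖ ^ r) = 0 := by
    rw [map_mul, map_zpow₀, S.unif_conj]
    linear_combination S.ϖ ^ r * htr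
  have hK : lowN hy ∈ C.K := hL.lowN_mem_K hy (hu.mul_zpow_mem_pE_iff.2 le_rfl)
  have hlow := isLowU_lowN hy
  have hnI : lowN hy ∉ S.Iw hL.hr := by
    intro h
    have := (hL.Iw_entries h).2.2.1
    rw [mat_lowN] at this
    have h2 := hu.mul_zpow_mem_pE_iff.1 (show u * S.ϖ ^ r ∈ S.pE (1 + r) by simpa [n'M] using this)
    omega
  have hpow : lowN hy ^ S.p ∈ C.KoneS := by
    rw [hL.mem_Kone, mem_MM_iff, lowN_zero_pow hy]
    have : (S.p : S.E) * (u * S.ϖ ^ r) ∈ S.pE (1 + r) :=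
      pE_mul (natCast_p_mem S) (hu.mul_zpow_mem_pE_iff.2 le_rfl)
    simpa [n'M, pE_zero_mem, eJ] using this
  let f : Function.End (C.K ⧸ hL.II) := MulAction.toEndHom (⟨lowN hy, hK⟩ : C.K)
  have hfix : ∀ k z : C.K, (MulAction.toEndHom z : Function.End (C.K ⧸ hL.II))
      (k : C.K ⧸ hL.II) = k ↔ (k : S.GG)⁻¹ * z * k ∈ S.Iw hL.hr := by
    intro k z
    show ((z * k : C.K) : C.K ⧸ hL.II) = k ↔ _
    rw [eq_comm, QuotientGroup.eq, mem_II]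
    simp [mul_assoc]
  have hf : f ^ S.p ^ 1 = 1 := by
    rw [pow_one, ← map_pow]
    funext x
    obtain ⟨k, rfl⟩ := QuotientGroup.mk_surjective x
    refine (hfix k _).2 (hL.Kone_le_Iw ?_)
    have := hL.Kone_normal hpow (C.K.inv_mem k.2)
    simpa using this
  have hfp : f.fixedPoints = {((⟨C.βK, hL.betaK_mem⟩ : C.K) : C.K ⧸ hL.II)} := by
    ext x
    obtain ⟨k, rfl⟩ := QuotientGroup.mk_surjective x
    refine Iff.trans (hfix k ⟨lowN hy, hK⟩) (Iff.trans ?_ Set.mem_singleton_iff.symm)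
    rw [eq_comm, QuotientGroup.eq, mem_II]
    have hbi : C.βK⁻¹ = C.βK := inv_eq_of_mul_eq_one_left hL.betaK_mul_self
    constructor
    · intro h
      obtain ⟨n, hn, hu', i, hi, e⟩ | ⟨i, hi, e⟩ := hL.K_decomp k.2
      · exfalso
        apply hnI
        have hc : lowN hy * n = n * lowN hy := by
          obtain ⟨h1, h2, h3, h4, h5, h6⟩ := hu'
          apply mat_ext
          ext a b
          rw [mat_mul, mat_mul, mat_lowN]
          fin_cases a <;> fin_cases b <;>
            simp [Matrix.mul_apply, Fin.sum_univ_three, n'M, h1, h2, h3, h4, h5, h6, add_comm]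
        have e2 : (k : S.GG)⁻¹ * lowN hy * k = i⁻¹ * lowN hy * i := by
          rw [e, mul_inv_rev]
          simp only [mul_assoc]
          rw [← mul_assoc (lowN hy), hc]
          group
        rw [show lowN hy = i * ((k : S.GG)⁻¹ * lowN hy * k) * i⁻¹ by rw [e2]; group]
        exact Subgroup.mul_mem _ (Subgroup.mul_mem _ hi h) (Subgroup.inv_mem _ hi)
      · simpa [e] using hi
    · intro h
      simp [hbi] at h
      have h1 := hL.I1_le_Iw (hL.betaK_conj_mem_I1 hK hlow)
      have e : (k : S.GG)⁻¹ * lowN hy * k =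
          (C.βK * k)⁻¹ * (C.βK * lowN hy * C.βK) * (C.βK * k) := by
        rw [mul_inv_rev, hbi]
        simp only [mul_assoc]
        rw [← mul_assoc C.βK C.βK, hL.betaK_mul_self, one_mul, ← mul_assoc C.βK C.βK,
          hL.betaK_mul_self, one_mul]
      show (k : S.GG)⁻¹ * lowN hy * k ∈ _
      rw [e]
      exact Subgroup.mul_mem _ (Subgroup.mul_mem _ (Subgroup.inv_mem _ h) h1) h
  have key := Equiv.Perm.card_fixedPoints_modEq hf
  have h1 (_ : Fintype f.fixedPoints) : Fintype.card f.fixedPoints = 1 := by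
    rw [← Nat.card_eq_fintype_card, Nat.card_eq_one_iff_exists]
    exact ⟨⟨_, hfp.superset rfl⟩, fun y => Subtype.ext (hfp.subset y.2)⟩
  rwa [h1, ← Nat.card_eq_fintype_card] at key

lemma card_quot_cast (𝔽 : Type) [Field 𝔽] [Algebra (ZMod S.p) 𝔽] :
    ((Nat.card (C.K ⧸ hL.II) : ℕ) : 𝔽) = 1 := by
  have h := (ZMod.natCast_eq_natCast_iff _ _ _).2 hL.card_quot_modEq
  have := congrArg (algebraMap (ZMod S.p) 𝔽) h
  simpa using this

end IsLevel

section CosetSums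

variable {Q M : Type*} [Group Q] (H : Subgroup Q)

lemma apply_out_mk {w : Q → M} (hw : ∀ k, ∀ i ∈ H, w (k * i) = w k) (k : Q) :
    w (k : Q ⧸ H).out = w k := by
  obtain ⟨h, e⟩ := QuotientGroup.mk_out_eq_mul H k
  rw [e, hw k h h.2]

lemma apply_out_smul {w : Q → M} (hw : ∀ k, ∀ i ∈ H, w (k * i) = w k) (k : Q) (x : Q ⧸ H) :
    w (k • x).out = w (k * x.out) := by
  conv_lhs => rw [← QuotientGroup.out_eq' x]
  exact apply_out_mk H hw (k * x.out)

lemma sum_mul_out [AddCommMonoid M] [Fintype (Q ⧸ H)] {w : Q → M}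
    (hw : ∀ k, ∀ i ∈ H, w (k * i) = w k) (k : Q) :
    ∑ x : Q ⧸ H, w (k * x.out) = ∑ x : Q ⧸ H, w x.out := by
  simp_rw [← apply_out_smul H hw k]
  exact Equiv.sum_comp (MulAction.toPerm k : Equiv.Perm (Q ⧸ H)) fun x => w x.out

end CosetSums

section Frobenius

variable {S : Setting} (C : Chamber S) {𝔽 : Type} [Field 𝔽]
variable {W V : Type} [AddCommGroup W] [Module 𝔽 W] [AddCommGroup V] [Module 𝔽 V]
variable (σ : Representation 𝔽 ↥C.K W) (ρ : Representation 𝔽 S.GG V)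

lemma ind_apply_mul {σ : Representation 𝔽 ↥C.K W} (F : IndSub C 𝔽 W σ) (k : C.K) (g : S.GG) :
    (F : S.GG → W) (k * g) = σ k ((F : S.GG → W) g) := F.2.1 k k.2 g

lemma indRep_apply {σ : Representation 𝔽 ↥C.K W} (F : IndSub C 𝔽 W σ) (g x : S.GG) :
    (indRep C 𝔽 W σ g F : S.GG → W) x = (F : S.GG → W) (x * g) := rfl

/-- The embedding `w ↦ [1, w]` of `σ` into `ind_K^G σ`. -/
def stdOne : W →ₗ[𝔽] IndSub C 𝔽 W σ where
  toFun w := ⟨stdFn C 𝔽 W σ 1 w, by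
    refine ⟨fun k hk g => ?_, {1}, fun g hg => ?_⟩
    · simp only [stdFn, mul_one]
      by_cases h : g ∈ C.K
      · rw [dif_pos h, dif_pos (C.K.mul_mem hk h), ← Module.End.mul_apply, ← map_mul]
        rfl
      · rw [dif_neg h, dif_neg (fun h' => h ((C.K.mul_mem_cancel_left hk).1 h')), map_zero]
    · by_cases h : g ∈ C.K
      · exact ⟨g, h, 1, by simp, by simp⟩
      · exact absurd (dif_neg (by simpa using h)) hg⟩
  map_add' a b := by
    ext g
    by_cases h : g ∈ C.K <;> simp [stdFn, h]
  map_smul' c a := by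
    ext g
    by_cases h : g ∈ C.K <;> simp [stdFn, h]

lemma stdOne_apply_mem (w : W) (k : C.K) : (stdOne C σ w : S.GG → W) k = σ k w := by
  show stdFn C 𝔽 W σ 1 w k = _
  simp [stdFn]

lemma stdOne_apply_not_mem (w : W) {g : S.GG} (hg : g ∉ C.K) :
    (stdOne C σ w : S.GG → W) g = 0 := by
  show stdFn C 𝔽 W σ 1 w g = _
  simp [stdFn, hg]

lemma indRep_stdOne (k : C.K) (w : W) :
    indRep C 𝔽 W σ k (stdOne C σ w) = stdOne C σ (σ k w) := by
  ext g
  rw [indRep_apply]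
  by_cases h : g ∈ C.K
  · have h1 := stdOne_apply_mem C σ w (⟨g, h⟩ * k)
    rw [map_mul] at h1
    exact h1.trans (stdOne_apply_mem C σ _ ⟨g, h⟩).symm
  · rw [stdOne_apply_not_mem C σ _ h,
      stdOne_apply_not_mem C σ _ fun h' => h ((C.K.mul_mem_cancel_right k.2).1 h')]

lemma eq_stdOne {F : IndSub C 𝔽 W σ} {w : W} (h1 : (F : S.GG → W) 1 = w)
    (h2 : ∀ g, (F : S.GG → W) g ≠ 0 → g ∈ C.K) : F = stdOne C σ w := by
  ext g
  by_cases h : g ∈ C.K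
  · have := ind_apply_mul C F ⟨g, h⟩ 1
    rw [h1, mul_one] at this
    exact this.trans (stdOne_apply_mem C σ w ⟨g, h⟩).symm
  · rw [stdOne_apply_not_mem C σ w h]
    by_contra h0
    exact h (h2 g h0)

variable {σ ρ} {θ : W →ₗ[𝔽] V}

lemma frob_term_mul (hθ : ∀ (k : C.K) w, θ (σ k w) = ρ k (θ w)) (F : IndSub C 𝔽 W σ) (g k : S.GG)
    (hk : k ∈ C.K) : ρ (g * k) (θ ((F : S.GG → W) (g * k)⁻¹)) = ρ g (θ ((F : S.GG → W) g⁻¹)) := by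
  have h := ind_apply_mul C F (⟨k, hk⟩⁻¹) g⁻¹
  have e : ((⟨k, hk⟩⁻¹ : C.K) : S.GG) = k⁻¹ := rfl
  rw [mul_inv_rev, ← e, h, hθ, e, map_mul, Module.End.mul_apply, ← Module.End.mul_apply, ← map_mul]
  simp

variable (ρ θ) in
/-- The summand at a coset of the map attached to `θ` by Frobenius reciprocity. -/
def frobTerm (F : IndSub C 𝔽 W σ) (x : S.GG ⧸ C.K) : V :=
  ρ x.out (θ ((F : S.GG → W) x.out⁻¹))

lemma frobTerm_mk (hθ : ∀ (k : C.K) w, θ (σ k w) = ρ k (θ w)) (F : IndSub C 𝔽 W σ) (g : S.GG) :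
    frobTerm C ρ θ F (g : S.GG ⧸ C.K) = ρ g (θ ((F : S.GG → W) g⁻¹)) :=
  apply_out_mk C.K (w := fun g => ρ g (θ ((F : S.GG → W) g⁻¹)))
    (fun a i hi => frob_term_mul C hθ F a i hi) g

variable (ρ θ) in
lemma frobTerm_finite (F : IndSub C 𝔽 W σ) : (Function.support (frobTerm C ρ θ F)).Finite := by
  obtain ⟨s, hs⟩ := F.2.2
  refine (s.finite_toSet.image fun t => ((t⁻¹ : S.GG) : S.GG ⧸ C.K)).subset fun x hx => ?_
  have h0 : (F : S.GG → W) x.out⁻¹ ≠ 0 := by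
    intro h
    apply hx
    simp [frobTerm, h]
  obtain ⟨k, hk, t, ht, e⟩ := hs _ h0
  refine ⟨t, ht, ?_⟩
  show ((t⁻¹ : S.GG) : S.GG ⧸ C.K) = x
  conv_rhs => rw [← QuotientGroup.out_eq' x]
  rw [QuotientGroup.eq, ← inv_inv x.out, e]
  simpa using hk

variable (ρ θ) in
/-- The map `ind_K^G σ → ρ` attached to `θ : σ → ρ` by Frobenius reciprocity. -/
def frob : IndSub C 𝔽 W σ →ₗ[𝔽] V where
  toFun F := ∑ᶠ x, frobTerm C ρ θ F x
  map_add' F F' := by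
    rw [← finsum_add_distrib (frobTerm_finite C ρ θ F) (frobTerm_finite C ρ θ F')]
    exact finsum_congr fun x => by simp [frobTerm]
  map_smul' c F := by
    rw [RingHom.id_apply, smul_finsum' c (frobTerm_finite C ρ θ F)]
    exact finsum_congr fun x => by simp [frobTerm]

lemma frob_equivariant (hθ : ∀ (k : C.K) w, θ (σ k w) = ρ k (θ w)) (g : S.GG)
    (F : IndSub C 𝔽 W σ) : frob C ρ θ (indRep C 𝔽 W σ g F) = ρ g (frob C ρ θ F) := by
  show ∑ᶠ x, frobTerm C ρ θ _ x = ρ g (∑ᶠ x, frobTerm C ρ θ F x)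
  rw [map_finsum (ρ g) (frobTerm_finite C ρ θ F),
    ← finsum_comp_equiv (MulAction.toPerm g : Equiv.Perm (S.GG ⧸ C.K))]
  refine finsum_congr fun x => ?_
  obtain ⟨y, rfl⟩ := QuotientGroup.mk_surjective x
  show frobTerm C ρ θ _ ((g * y : S.GG) : S.GG ⧸ C.K) = _
  rw [frobTerm_mk C hθ, frobTerm_mk C hθ, indRep_apply, map_mul]
  simp

lemma frob_stdOne (hθ : ∀ (k : C.K) w, θ (σ k w) = ρ k (θ w)) (w : W) :
    frob C ρ θ (stdOne C σ w) = θ w := by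
  show ∑ᶠ x, frobTerm C ρ θ _ x = _
  rw [finsum_eq_single _ ((1 : S.GG) : S.GG ⧸ C.K)]
  · rw [frobTerm_mk C hθ]
    have := stdOne_apply_mem C σ w 1
    simp only [OneMemClass.coe_one] at this
    simp [this]
  · intro x hx
    have : x.out⁻¹ ∉ C.K := by
      intro h
      apply hx
      conv_lhs => rw [← QuotientGroup.out_eq' x]
      rw [QuotientGroup.eq]
      simpa using h
    rw [frobTerm, stdOne_apply_not_mem C σ w this, map_zero, map_zero]

lemma frob_stdOne_eq_self (F : IndSub C 𝔽 W σ) :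
    frob C (indRep C 𝔽 W σ) (stdOne C σ) F = F := by
  ext y
  have hfin := frobTerm_finite C (indRep C 𝔽 W σ) (stdOne C σ) F
  let ev : IndSub C 𝔽 W σ →+ W :=
    { toFun := fun F => (F : S.GG → W) y, map_zero' := rfl, map_add' := fun _ _ => rfl }
  show ev (∑ᶠ x, frobTerm C (indRep C 𝔽 W σ) (stdOne C σ) F x) = _
  rw [map_finsum ev hfin, finsum_eq_single _ ((y⁻¹ : S.GG) : S.GG ⧸ C.K)]
  · rw [frobTerm_mk C fun k w => (indRep_stdOne C σ k w).symm]
    show (stdOne C σ ((F : S.GG → W) y⁻¹⁻¹) : S.GG → W) (y * y⁻¹) = _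
    rw [inv_inv, mul_inv_cancel]
    have := stdOne_apply_mem C σ ((F : S.GG → W) y) 1
    simpa using this
  · intro x hx
    show (stdOne C σ ((F : S.GG → W) x.out⁻¹) : S.GG → W) (y * x.out) = _
    apply stdOne_apply_not_mem
    intro h
    apply hx
    conv_lhs => rw [← QuotientGroup.out_eq' x]
    exact (QuotientGroup.eq.2 (by simpa using h)).symm

/-- A `G`-map out of `ind_K^G σ` vanishing on `[1, σ]` is zero. -/
lemma eq_zero_of_stdOne {Φ : IndSub C 𝔽 W σ →ₗ[𝔽] V}
    (hΦ : ∀ g x, Φ (indRep C 𝔽 W σ g x) = ρ g (Φ x)) (h : ∀ w, Φ (stdOne C σ w) = 0) : Φ = 0 := by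
  ext F
  rw [← frob_stdOne_eq_self C F]
  show Φ (∑ᶠ x, frobTerm C (indRep C 𝔽 W σ) (stdOne C σ) F x) = 0
  rw [map_finsum Φ (frobTerm_finite C (indRep C 𝔽 W σ) (stdOne C σ) F)]
  exact finsum_eq_zero_of_forall_eq_zero fun x => by rw [frobTerm, hΦ, h, map_zero]

end Frobenius

/-- The compact induction of the trivial weight. -/
abbrev IndOne {S : Setting} (C : Chamber S) (𝔽 : Type) [Field 𝔽] :=
  IndSub C 𝔽 𝔽 (1 : Representation 𝔽 C.K 𝔽)

section

variable {S : Setting} {C : Chamber S} {𝔽 : Type} [Field 𝔽]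

lemma indOne_apply_mul (v : IndOne C 𝔽) {k : S.GG} (hk : k ∈ C.K) (g : S.GG) :
    (v : S.GG → 𝔽) (k * g) = (v : S.GG → 𝔽) g := v.2.1 k hk g

lemma indOne_apply_mul_assoc (v : IndOne C 𝔽) {k : S.GG} (hk : k ∈ C.K) (g g' : S.GG) :
    (v : S.GG → 𝔽) (k * g * g') = (v : S.GG → 𝔽) (g * g') := by
  rw [mul_assoc, indOne_apply_mul v hk]

lemma coe_sum_indOne {ι : Type*} (s : Finset ι) (f : ι → IndOne C 𝔽) (g : S.GG) :
    ((∑ a ∈ s, f a : IndOne C 𝔽) : S.GG → 𝔽) g = ∑ a ∈ s, (f a : S.GG → 𝔽) g := by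
  rw [AddSubmonoidClass.coe_finsetSum, Finset.sum_apply]

end

namespace IsLevel

variable {S : Setting} {C : Chamber S} {r : ℤ} (hL : IsLevel C r) {𝔽 : Type} [Field 𝔽]

/-- Right invariance under the Iwahori subgroup. -/
def RInv (v : IndOne C 𝔽) : Prop :=
  ∀ x, ∀ i ∈ S.Iw hL.hr, (v : S.GG → 𝔽) (x * i) = (v : S.GG → 𝔽) x

include hL

lemma rInv_of_I1 {v : IndOne C 𝔽} (hv : ∀ g ∈ C.I1, indRep C 𝔽 𝔽 1 g v = v) : hL.RInv v := by
  have key : ∀ m : ℤ, ∀ i ∈ S.Iw hL.hr,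
      (v : S.GG → 𝔽) (S.alphaE ^ m * i) = (v : S.GG → 𝔽) (S.alphaE ^ m) := by
    intro m i hi
    obtain ⟨h, -, hc, hK, j, hj, rfl⟩ := hL.Iw_decomp hi
    have e := congrFun (congrArg Subtype.val (hv j hj)) (S.alphaE ^ m * h)
    rw [indRep_apply] at e
    rw [← mul_assoc, e, ← hc, indOne_apply_mul v hK]
  intro x i hi
  obtain ⟨k, hk, m, i', hi', rfl⟩ := hL.exists_cov x
  simp only [mul_assoc, indOne_apply_mul v hk]
  rw [key m _ (Subgroup.mul_mem _ hi' hi), key m _ hi']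

lemma RInv.eq_of_alpha {v w : IndOne C 𝔽} (hv : hL.RInv v) (hw : hL.RInv w)
    (h : ∀ m : ℤ, (v : S.GG → 𝔽) (S.alphaE ^ m) = (w : S.GG → 𝔽) (S.alphaE ^ m)) : v = w := by
  ext x
  obtain ⟨k, hk, m, i', hi', rfl⟩ := hL.exists_cov x
  rw [hv _ _ hi', hw _ _ hi', indOne_apply_mul v hk, indOne_apply_mul w hk, h]

lemma RInv.apply_mul {v : IndOne C 𝔽} (hv : hL.RInv v) (g : S.GG) (k : C.K) (i : C.K)
    (hi : i ∈ hL.II) :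
    (v : S.GG → 𝔽) (g * ((k * i : C.K) : S.GG)) = (v : S.GG → 𝔽) (g * k) := by
  rw [Subgroup.coe_mul, ← mul_assoc, hv _ _ (hL.mem_II.1 hi)]

lemma RInv.indRep_mul {v : IndOne C 𝔽} (hv : hL.RInv v) (k : C.K) (i : C.K) (hi : i ∈ hL.II) :
    indRep C 𝔽 𝔽 1 ((k * i : C.K) : S.GG) v = indRep C 𝔽 𝔽 1 k v := by
  ext g
  exact hv.apply_mul hL g k i hi

/-- The Iwahori-invariant functions vanishing on `α^{-m}` for `m ≥ 0`. -/
def Zsub (𝔽 : Type) [Field 𝔽] : Submodule 𝔽 (IndOne C 𝔽) where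
  carrier := {v | hL.RInv v ∧ ∀ m : ℤ, 0 ≤ m → (v : S.GG → 𝔽) (S.alphaE ^ (-m)) = 0}
  add_mem' := by
    rintro v w ⟨hv, hv'⟩ ⟨hw, hw'⟩
    exact ⟨fun x i hi => congrArg₂ (· + ·) (hv x i hi) (hw x i hi),
      fun m hm => (congrArg₂ (· + ·) (hv' m hm) (hw' m hm)).trans (add_zero 0)⟩
  zero_mem' := ⟨fun _ _ _ => rfl, fun _ _ => rfl⟩
  smul_mem' := by
    rintro c v ⟨hv, hv'⟩
    exact ⟨fun x i hi => congrArg (c * ·) (hv x i hi),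
      fun m hm => (congrArg (c * ·) (hv' m hm)).trans (mul_zero c)⟩

variable [Fintype (C.K ⧸ hL.II)]

lemma sum_alpha [Algebra (ZMod S.p) 𝔽] {v : IndOne C 𝔽} (hv : hL.RInv v) {m : ℤ} (hm : 0 ≤ m) :
    ∑ x : C.K ⧸ hL.II, (v : S.GG → 𝔽) (S.alphaE ^ m * (x.out : S.GG)) =
      (v : S.GG → 𝔽) (S.alphaE ^ (-m)) := by
  set b : C.K := ⟨C.βK, hL.betaK_mem⟩ with hb
  have hval : ∀ x : C.K ⧸ hL.II, (v : S.GG → 𝔽) (S.alphaE ^ m * (x.out : S.GG)) =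
      (v : S.GG → 𝔽) (S.alphaE ^ m) + if x = (b : C.K ⧸ hL.II) then
        (v : S.GG → 𝔽) (S.alphaE ^ (-m)) - (v : S.GG → 𝔽) (S.alphaE ^ m) else 0 := by
    intro x
    split_ifs with hx
    · rw [hx, apply_out_mk hL.II (w := fun k : C.K => (v : S.GG → 𝔽) (S.alphaE ^ m * k))
        fun k i hi => hv.apply_mul hL _ k i hi]
      show (v : S.GG → 𝔽) (S.alphaE ^ m * C.βK) = _
      rw [hL.alpha_zpow_mul_betaK, indOne_apply_mul v hL.betaK_mem]
      ring
    · rw [add_zero]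
      obtain ⟨n, hn, hu, i, hi, e⟩ | ⟨i, hi, e⟩ := hL.K_decomp x.out.2
      · rw [e, ← mul_assoc, hv _ _ hi, show S.alphaE ^ m * n =
          S.alphaE ^ m * n * S.alphaE ^ (-m) * S.alphaE ^ m by group,
          indOne_apply_mul v (hL.alpha_conj_mem hn hu hm)]
      · exfalso
        apply hx
        conv_lhs => rw [← QuotientGroup.out_eq' x]
        refine (QuotientGroup.eq.2 ?_).symm
        rw [mem_II]
        have : ((b⁻¹ * x.out : C.K) : S.GG) = i := by
          rw [Subgroup.coe_mul, e, Subgroup.coe_inv, inv_mul_cancel_left]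
        rwa [this]
  have hcard : ((Fintype.card (C.K ⧸ hL.II) : ℕ) : 𝔽) = 1 := by
    rw [← Nat.card_eq_fintype_card]
    exact hL.card_quot_cast 𝔽
  rw [Finset.sum_congr rfl fun x _ => hval x, Finset.sum_add_distrib, Finset.sum_const,
    Finset.sum_ite_eq', if_pos (Finset.mem_univ _), Finset.card_univ, nsmul_eq_mul, hcard]
  ring

lemma sum_indRep_eq_zero [Algebra (ZMod S.p) 𝔽] {v : IndOne C 𝔽} (hv : v ∈ hL.Zsub 𝔽) :
    ∑ x : C.K ⧸ hL.II, indRep C 𝔽 𝔽 1 (x.out : S.GG) v = 0 := by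
  obtain ⟨hI, h0⟩ := hv
  have reindex : ∀ (g : S.GG) (k : C.K),
      ∑ x : C.K ⧸ hL.II, (v : S.GG → 𝔽) (g * k * (x.out : S.GG)) =
        ∑ x : C.K ⧸ hL.II, (v : S.GG → 𝔽) (g * (x.out : S.GG)) := by
    intro g k
    have := sum_mul_out hL.II (w := fun k : C.K => (v : S.GG → 𝔽) (g * k))
      (fun k i hi => hI.apply_mul hL _ k i hi) k
    simpa [mul_assoc] using this
  have hα : ∀ m : ℤ, ∑ x : C.K ⧸ hL.II, (v : S.GG → 𝔽) (S.alphaE ^ m * (x.out : S.GG)) = 0 := by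
    intro m
    obtain hm | hm := le_total 0 m
    · rw [hL.sum_alpha hI hm, h0 m hm]
    · have e : S.alphaE ^ m = C.βK * S.alphaE ^ (-m) * C.βK := by
        rw [mul_assoc, hL.alpha_zpow_mul_betaK, ← mul_assoc, hL.betaK_mul_self, one_mul, neg_neg]
      have h1 := reindex (S.alphaE ^ (-m)) ⟨C.βK, hL.betaK_mem⟩
      rw [hL.sum_alpha hI (by omega), h0 (-m) (by omega)] at h1
      rw [← h1, e]
      refine Finset.sum_congr rfl fun x _ => ?_
      simp only [mul_assoc]
      rw [indOne_apply_mul v hL.betaK_mem]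
  ext g
  rw [coe_sum_indOne]
  obtain ⟨k, hk, m, i, hi, rfl⟩ := hL.exists_cov g
  have h1 := reindex (k * S.alphaE ^ m) ⟨i, hL.Iw_le_K hi⟩
  refine h1.trans ((Finset.sum_congr rfl fun x _ => ?_).trans (hα m))
  exact indOne_apply_mul_assoc v hk _ _

end IsLevel

namespace IsLevel

variable {S : Setting} {C : Chamber S} {r : ℤ} (hL : IsLevel C r) {𝔽 : Type} [Field 𝔽]

include hL

lemma fFamily_rInv {v0 : 𝔽} {ff : ℤ → IndOne C 𝔽} (hff : IsFFamily C 𝔽 𝔽 1 v0 ff) (n : ℤ) :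
    hL.RInv (ff n) := hL.rInv_of_I1 (hff.2.2.1 n)

lemma fFamily_apply {v0 : 𝔽} {ff : ℤ → IndOne C 𝔽} (hff : IsFFamily C 𝔽 𝔽 1 v0 ff) {n : ℤ}
    (hn : 1 ≤ n) (m : ℤ) : (ff (-n) : S.GG → 𝔽) (S.alphaE ^ m) = if m = n then v0 else 0 := by
  split_ifs with h
  · subst h
    simpa using hff.2.2.2.2.2 (-m) (by omega)
  · by_contra h0
    obtain ⟨k, hk, i, hi, e⟩ := hff.2.2.2.1 _ _ h0
    rw [neg_neg] at e
    refine h (hL.alpha_zpow_inj (hL.I1_le_Iw hi) ?_).symm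
    have : S.alphaE ^ n * i * S.alphaE ^ (-m) = k⁻¹ := by
      rw [zpow_neg, e]
      group
    rw [this]
    exact C.K.inv_mem hk

lemma finite_alpha_support (v : IndOne C 𝔽) :
    {n : ℤ | (v : S.GG → 𝔽) (S.alphaE ^ n) ≠ 0}.Finite := by
  obtain ⟨s, hs⟩ := v.2.2
  choose! k hk t ht e using fun n : ℤ => hs (S.alphaE ^ n)
  refine Set.Finite.of_injOn (f := t) (t := (s : Set S.GG)) (fun n hn => ht n hn) ?_ s.finite_toSet
  intro n hn m hm h
  refine hL.alpha_zpow_inj (Subgroup.one_mem _) ?_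
  have h' : t n = t m := h
  rw [mul_one, e n hn, zpow_neg, e m hm, h', mul_inv_rev]
  have : k n * t m * ((t m)⁻¹ * (k m)⁻¹) = k n * (k m)⁻¹ := by group
  rw [this]
  exact C.K.mul_mem (hk n hn) (C.K.inv_mem (hk m hm))

lemma span_eq_Zsub {v0 : 𝔽} {ff : ℤ → IndOne C 𝔽} (hff : IsFFamily C 𝔽 𝔽 1 v0 ff) :
    Submodule.span 𝔽 {v : IndOne C 𝔽 | ∃ n : ℤ, 1 ≤ n ∧ v = ff (-n)} = hL.Zsub 𝔽 := by
  have hsub : ∀ n : ℤ, 1 ≤ n → ff (-n) ∈ hL.Zsub 𝔽 := fun n hn =>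
    ⟨hL.fFamily_rInv hff _, fun m hm => by
      rw [hL.fFamily_apply hff hn, if_neg (by omega)]⟩
  apply le_antisymm
  · rw [Submodule.span_le]
    rintro _ ⟨n, hn, rfl⟩
    exact hsub n hn
  · intro v hv
    have hfin := hL.finite_alpha_support v
    have hpos : ∀ n ∈ hfin.toFinset, 1 ≤ n := by
      intro n hn
      by_contra h
      exact (hfin.mem_toFinset.1 hn) (by simpa using hv.2 (-n) (by omega))
    have hw : ∑ n ∈ hfin.toFinset, ((v : S.GG → 𝔽) (S.alphaE ^ n) / v0) • ff (-n) ∈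
        Submodule.span 𝔽 {v : IndOne C 𝔽 | ∃ n : ℤ, 1 ≤ n ∧ v = ff (-n)} :=
      Submodule.sum_mem _ fun n hn =>
        Submodule.smul_mem _ _ (Submodule.subset_span ⟨n, hpos n hn, rfl⟩)
    convert hw using 1
    refine hv.1.eq_of_alpha hL (Submodule.sum_mem (hL.Zsub 𝔽) fun n hn =>
      Submodule.smul_mem _ _ (hsub n (hpos n hn))).1 fun m => ?_
    rw [coe_sum_indOne]
    have : ∀ n ∈ hfin.toFinset, ((((v : S.GG → 𝔽) (S.alphaE ^ n) / v0) • ff (-n) : IndOne C 𝔽) :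
        S.GG → 𝔽) (S.alphaE ^ m) = if m = n then (v : S.GG → 𝔽) (S.alphaE ^ n) else 0 := by
      intro n hn
      show (v : S.GG → 𝔽) (S.alphaE ^ n) / v0 * (ff (-n) : S.GG → 𝔽) (S.alphaE ^ m) = _
      rw [hL.fFamily_apply hff (hpos n hn)]
      split_ifs
      · exact div_mul_cancel₀ _ hff.1
      · exact mul_zero _
    rw [Finset.sum_congr rfl this, Finset.sum_ite_eq]
    split_ifs with h
    · rfl
    · by_contra h0
      exact h (hfin.mem_toFinset.2 h0)

end IsLevel

section PrincipalSeries

variable {S : Setting} {C : Chamber S} {r : ℤ} (hL : IsLevel C r) {𝔽 : Type} [Field 𝔽]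

lemma sigma'_coe {W : Type} [AddCommGroup W] [Module 𝔽 W] (σ : Representation 𝔽 C.K W) (k : C.K) :
    sigma' C 𝔽 W σ k = σ k := by
  rw [sigma', dif_pos k.2]

namespace IsLevel

include hL

lemma PS1_left {f : C.K → 𝔽} (hf : f ∈ PS1sub C 𝔽) (i : C.K) (hi : i ∈ hL.II) (x : C.K) :
    f (i * x) = f x := by
  obtain ⟨h, hh, -, hK, j, hj, e⟩ := hL.Iw_decomp (hL.mem_II.1 hi)
  have : i = ⟨h, hK⟩ * ⟨j, hL.Iw_le_K (hL.I1_le_Iw hj)⟩ := Subtype.ext e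
  rw [this, mul_assoc, hf.2.1 ⟨h, hK⟩ hh, one_mul, hf.1 ⟨j, _⟩ hj]

lemma PSact_mem {f : C.K → 𝔽} (hf : f ∈ PS1sub C 𝔽) (k : C.K) : PSact C 𝔽 k f ∈ PS1sub C 𝔽 := by
  refine ⟨fun b hb x => ?_, fun h hh x => ?_, fun z hz x => ?_⟩
  · rw [PSact, mul_assoc, hf.1 b hb]
    rfl
  · rw [PSact, mul_assoc, hf.2.1 h hh]
    rfl
  · show f (x * z * k) = f (x * k)
    rw [← hf.2.2 (k⁻¹ * z * k) (by simpa using hL.Kone_normal hz (C.K.inv_mem k.2)) (x * k)]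
    congr 1
    group

/-- The function in the principal series supported on the Iwahori subgroup. -/
def indI (𝔽 : Type) [Field 𝔽] : PS1sub C 𝔽 :=
  ⟨fun x => if x ∈ hL.II then 1 else 0, by
    refine ⟨fun b hb x => ?_, fun h hh x => ?_, fun z hz x => ?_⟩
    · show (if b * x ∈ hL.II then (1 : 𝔽) else 0) = if x ∈ hL.II then 1 else 0
      rw [hL.II.mul_mem_cancel_left (hL.mem_II.2 (hL.I1_le_Iw hb))]
    · show (if h * x ∈ hL.II then (1 : 𝔽) else 0) = 1 * if x ∈ hL.II then 1 else 0
      rw [hL.II.mul_mem_cancel_left (hL.mem_II.2 (hL.H0_le_Iw hh)), one_mul]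
    · show (if x * z ∈ hL.II then (1 : 𝔽) else 0) = if x ∈ hL.II then 1 else 0
      rw [hL.II.mul_mem_cancel_right (hL.mem_II.2 (hL.Kone_le_Iw hz))]⟩

lemma indI_apply (x : C.K) : (hL.indI 𝔽 : C.K → 𝔽) x = if x ∈ hL.II then 1 else 0 := rfl

/-- An `I₁`-invariant element of the principal series is a combination of a constant and the
function supported on the Iwahori subgroup. -/
lemma eq_const_add_indI {f : C.K → 𝔽} (hf : f ∈ PS1sub C 𝔽)
    (h : ∀ u : C.K, (u : S.GG) ∈ C.I1 → ∀ x, f (x * u) = f x) :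
    ∃ a b : 𝔽, ∀ x, f x = a + b * (hL.indI 𝔽 : C.K → 𝔽) x := by
  refine ⟨f ⟨C.βK, hL.betaK_mem⟩, f 1 - f ⟨C.βK, hL.betaK_mem⟩, fun x => ?_⟩
  rw [indI_apply]
  split_ifs with hx
  · have := hL.PS1_left hf x hx 1
    rw [mul_one] at this
    rw [this]
    ring
  · obtain hi | ⟨i, hi, u, hu, e⟩ := hL.K_decomp_left x.2
    · exact absurd (hL.mem_II.2 hi) hx
    · have : x = ⟨i, hL.Iw_le_K hi⟩ * ⟨C.βK, hL.betaK_mem⟩ *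
          ⟨u, hL.Iw_le_K (hL.I1_le_Iw hu)⟩ := Subtype.ext e
      rw [this, h _ hu, hL.PS1_left hf _ (hL.mem_II.2 hi)]
      ring

variable {Wst : Type} [AddCommGroup Wst] [Module 𝔽 Wst] {σst : Representation 𝔽 C.K Wst}
  {φ : PS1sub C 𝔽 →ₗ[𝔽] Wst}

lemma map_indI_fixed
    (heq : ∀ (k : C.K) (f f' : PS1sub C 𝔽), (f' : C.K → 𝔽) = PSact C 𝔽 k f → φ f' = σst k (φ f))
    {i : C.K} (hi : i ∈ hL.II) : σst i (φ (hL.indI 𝔽)) = φ (hL.indI 𝔽) := by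
  refine (heq i _ _ ?_).symm
  funext x
  show _ = (hL.indI 𝔽 : C.K → 𝔽) (x * i)
  rw [indI_apply, indI_apply, hL.II.mul_mem_cancel_right hi]

/-- The `I₁`-invariants of the Steinberg weight are spanned by the image of the function
supported on the Iwahori subgroup. -/
lemma exists_smul_map_indI (hsurj : Function.Surjective φ)
    (hker : ∀ f : PS1sub C 𝔽, φ f = 0 ↔ ∃ c : 𝔽, (f : C.K → 𝔽) = fun _ => c)
    (heq : ∀ (k : C.K) (f f' : PS1sub C 𝔽), (f' : C.K → 𝔽) = PSact C 𝔽 k f → φ f' = σst k (φ f))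
    {v : Wst} (hv : ∀ g ∈ C.I1, sigma' C 𝔽 Wst σst g v = v) : ∃ c : 𝔽, v = c • φ (hL.indI 𝔽) := by
  obtain ⟨f, rfl⟩ := hsurj v
  have hinv : ∀ u : C.K, (u : S.GG) ∈ C.I1 → ∀ x, (f : C.K → 𝔽) (x * u) = (f : C.K → 𝔽) x := by
    intro u hu
    have h1 := hv u hu
    rw [sigma'_coe, ← heq u f ⟨_, hL.PSact_mem f.2 u⟩ rfl, ← sub_eq_zero, ← map_sub, hker] at h1
    obtain ⟨c, hc⟩ := h1
    have hc' : ∀ x, (f : C.K → 𝔽) (x * u) - (f : C.K → 𝔽) x = c := congrFun hc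
    have h0 : (f : C.K → 𝔽) (1 * u) = (f : C.K → 𝔽) 1 := by
      have := hL.PS1_left f.2 u (hL.mem_II.2 (hL.I1_le_Iw hu)) 1
      rwa [mul_one, ← one_mul u] at this
    have hc0 := hc' 1
    rw [h0, sub_self] at hc0
    intro x
    rw [← sub_eq_zero, hc', hc0]
  obtain ⟨a, b, h⟩ := hL.eq_const_add_indI f.2 hinv
  refine ⟨b, ?_⟩
  rw [← map_smul, ← sub_eq_zero, ← map_sub, hker]
  refine ⟨a, funext fun x => ?_⟩
  show (f : C.K → 𝔽) x - b * _ = a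
  rw [h]
  ring

lemma sum_map_indI [Fintype (C.K ⧸ hL.II)]
    (hker : ∀ f : PS1sub C 𝔽, φ f = 0 ↔ ∃ c : 𝔽, (f : C.K → 𝔽) = fun _ => c)
    (heq : ∀ (k : C.K) (f f' : PS1sub C 𝔽), (f' : C.K → 𝔽) = PSact C 𝔽 k f → φ f' = σst k (φ f)) :
    ∑ x : C.K ⧸ hL.II, σst x.out (φ (hL.indI 𝔽)) = 0 := by
  have h1 : ∀ k : C.K, σst k (φ (hL.indI 𝔽)) = φ ⟨_, hL.PSact_mem (hL.indI 𝔽).2 k⟩ := fun k =>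
    (heq k _ ⟨_, hL.PSact_mem (hL.indI 𝔽).2 k⟩ rfl).symm
  simp_rw [h1]
  rw [← map_sum, hker]
  refine ⟨∑ x : C.K ⧸ hL.II, (hL.indI 𝔽 : C.K → 𝔽) x.out, funext fun y => ?_⟩
  rw [AddSubmonoidClass.coe_finsetSum, Finset.sum_apply]
  refine sum_mul_out hL.II (w := (hL.indI 𝔽 : C.K → 𝔽)) (fun k i hi => ?_) y
  rw [indI_apply, indI_apply, hL.II.mul_mem_cancel_right hi]

end IsLevel
end PrincipalSeries

namespace IsLevel

variable {S : Setting} {C : Chamber S} {r : ℤ} (hL : IsLevel C r) {𝔽 : Type} [Field 𝔽]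
  {Wst : Type} [AddCommGroup Wst] [Module 𝔽 Wst] {σst : Representation 𝔽 C.K Wst}
  {φ : PS1sub C 𝔽 →ₗ[𝔽] Wst}

section

include hL

lemma psMap_term {v : IndOne C 𝔽} (hv : hL.RInv v) {f : C.K → 𝔽} (hf : f ∈ PS1sub C 𝔽)
    (k i : C.K) (hi : i ∈ hL.II) :
    f (k * i)⁻¹ • indRep C 𝔽 𝔽 1 ((k * i : C.K) : S.GG) v =
      f k⁻¹ • indRep C 𝔽 𝔽 1 (k : S.GG) v := by
  rw [mul_inv_rev, hL.PS1_left hf _ (inv_mem hi), hv.indRep_mul hL k i hi]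

end

variable [Fintype (C.K ⧸ hL.II)]

/-- The map from the principal series of `K` attached to an Iwahori-invariant vector. -/
def psMap (v : IndOne C 𝔽) : PS1sub C 𝔽 →ₗ[𝔽] IndOne C 𝔽 where
  toFun f := ∑ x : C.K ⧸ hL.II, (f : C.K → 𝔽) x.out⁻¹ • indRep C 𝔽 𝔽 1 (x.out : S.GG) v
  map_add' f g := by
    rw [← Finset.sum_add_distrib]
    exact Finset.sum_congr rfl fun x _ => add_smul _ _ _
  map_smul' c f := by
    rw [RingHom.id_apply, Finset.smul_sum]
    exact Finset.sum_congr rfl fun x _ => mul_smul _ _ _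

include hL

lemma psMap_act {v : IndOne C 𝔽} (hv : hL.RInv v) (k : C.K) (f f' : PS1sub C 𝔽)
    (h : (f' : C.K → 𝔽) = PSact C 𝔽 k f) :
    hL.psMap v f' = indRep C 𝔽 𝔽 1 (k : S.GG) (hL.psMap v f) := by
  have key := sum_mul_out hL.II
    (w := fun y : C.K => (f' : C.K → 𝔽) y⁻¹ • indRep C 𝔽 𝔽 1 (y : S.GG) v)
    (fun y i hi => hL.psMap_term hv f'.2 y i hi) k
  show ∑ x : C.K ⧸ hL.II, _ = indRep C 𝔽 𝔽 1 (k : S.GG) (∑ x : C.K ⧸ hL.II, _)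
  rw [map_sum]
  refine key.symm.trans (Finset.sum_congr rfl fun x _ => ?_)
  rw [map_smul, ← Module.End.mul_apply, ← map_mul, h]
  show (f : C.K → 𝔽) ((k * x.out)⁻¹ * k) • _ = _
  rw [mul_inv_rev, inv_mul_cancel_right]
  rfl

lemma psMap_indI {v : IndOne C 𝔽} (hv : hL.RInv v) : hL.psMap v (hL.indI 𝔽) = v := by
  show ∑ x : C.K ⧸ hL.II, _ = v
  rw [Finset.sum_eq_single ((1 : C.K) : C.K ⧸ hL.II)]
  · refine (apply_out_mk hL.II
      (w := fun y : C.K => (hL.indI 𝔽 : C.K → 𝔽) y⁻¹ • indRep C 𝔽 𝔽 1 (y : S.GG) v)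
      (fun y i hi => hL.psMap_term hv (hL.indI 𝔽).2 y i hi) 1).trans ?_
    show (hL.indI 𝔽 : C.K → 𝔽) 1⁻¹ • indRep C 𝔽 𝔽 1 ((1 : C.K) : S.GG) v = v
    rw [inv_one, indI_apply, if_pos (one_mem _), one_smul, OneMemClass.coe_one, map_one]
    rfl
  · intro x _ hx
    rw [indI_apply, if_neg, zero_smul]
    intro h
    apply hx
    conv_lhs => rw [← QuotientGroup.out_eq' x]
    rw [QuotientGroup.eq]
    simpa using h
  · intro h
    exact absurd (Finset.mem_univ _) h

lemma psMap_const [Algebra (ZMod S.p) 𝔽] {v : IndOne C 𝔽} (hv : v ∈ hL.Zsub 𝔽) {f : PS1sub C 𝔽}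
    {c : 𝔽} (hf : (f : C.K → 𝔽) = fun _ => c) : hL.psMap v f = 0 := by
  show ∑ x : C.K ⧸ hL.II, (f : C.K → 𝔽) x.out⁻¹ • _ = _
  rw [hf, ← Finset.smul_sum, hL.sum_indRep_eq_zero hv, smul_zero]

lemma exists_map_of_mem_Zsub [Algebra (ZMod S.p) 𝔽] (hsurj : Function.Surjective φ)
    (hker : ∀ f : PS1sub C 𝔽, φ f = 0 ↔ ∃ c : 𝔽, (f : C.K → 𝔽) = fun _ => c)
    (heq : ∀ (k : C.K) (f f' : PS1sub C 𝔽), (f' : C.K → 𝔽) = PSact C 𝔽 k f → φ f' = σst k (φ f))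
    {v : IndOne C 𝔽} (hv : v ∈ hL.Zsub 𝔽) :
    ∃ θ : Wst →ₗ[𝔽] IndOne C 𝔽, (∀ (k : C.K) w, θ (σst k w) = indRep C 𝔽 𝔽 1 (k : S.GG) (θ w)) ∧
      θ (φ (hL.indI 𝔽)) = v := by
  have hle : LinearMap.ker φ ≤ LinearMap.ker (hL.psMap v) := by
    intro f hf
    obtain ⟨c, hc⟩ := (hker f).1 hf
    exact hL.psMap_const hv hc
  let e := φ.quotKerEquivOfSurjective hsurj
  let θ : Wst →ₗ[𝔽] IndOne C 𝔽 := (Submodule.liftQ _ _ hle).comp e.symm.toLinearMap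
  have hθ : ∀ f, θ (φ f) = hL.psMap v f := by
    intro f
    have : e.symm (φ f) = Submodule.Quotient.mk f := by
      rw [LinearEquiv.symm_apply_eq]
      rfl
    show Submodule.liftQ _ _ hle (e.symm (φ f)) = _
    rw [this, Submodule.liftQ_apply]
  refine ⟨θ, fun k w => ?_, ?_⟩
  · obtain ⟨f, rfl⟩ := hsurj w
    rw [← heq k f ⟨_, hL.PSact_mem f.2 k⟩ rfl, hθ, hθ]
    exact hL.psMap_act hv.1 k _ _ rfl
  · rw [hθ, hL.psMap_indI hv.1]

lemma exists_hom_of_mem_Zsub [Algebra (ZMod S.p) 𝔽] (hst : IsSteinberg C 𝔽 σst) {v0 : Wst}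
    (hv0 : v0 ≠ 0) (hI : ∀ g ∈ C.I1, sigma' C 𝔽 Wst σst g v0 = v0) {v : IndOne C 𝔽}
    (hv : v ∈ hL.Zsub 𝔽) : ∃ Φ ∈ EquivHomSub 𝔽 (indRep C 𝔽 Wst σst) (indRep C 𝔽 𝔽 1),
      Φ (stdOne C σst v0) = v := by
  obtain ⟨φ, hsurj, hker, heq⟩ := hst
  obtain ⟨c, rfl⟩ := hL.exists_smul_map_indI hsurj hker heq hI
  have hc : c ≠ 0 := by
    rintro rfl
    exact hv0 (zero_smul _ _)
  obtain ⟨θ, hθ, hθv⟩ := hL.exists_map_of_mem_Zsub hsurj hker heq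
    (Submodule.smul_mem _ c⁻¹ hv)
  refine ⟨frob C (indRep C 𝔽 𝔽 1) θ, frob_equivariant C hθ, ?_⟩
  rw [frob_stdOne C hθ, map_smul, hθv, smul_inv_smul₀ hc]

lemma hom_apply_mem_Zsub [Algebra (ZMod S.p) 𝔽] (hst : IsSteinberg C 𝔽 σst) {v0 : Wst}
    (hI : ∀ g ∈ C.I1, sigma' C 𝔽 Wst σst g v0 = v0)
    {Φ : IndSub C 𝔽 Wst σst →ₗ[𝔽] IndOne C 𝔽}
    (hΦ : Φ ∈ EquivHomSub 𝔽 (indRep C 𝔽 Wst σst) (indRep C 𝔽 𝔽 1)) :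
    Φ (stdOne C σst v0) ∈ hL.Zsub 𝔽 := by
  obtain ⟨φ, hsurj, hker, heq⟩ := hst
  obtain ⟨c, rfl⟩ := hL.exists_smul_map_indI hsurj hker heq hI
  rw [map_smul, map_smul]
  refine Submodule.smul_mem _ c ?_
  have hK : ∀ (k : C.K) w, indRep C 𝔽 𝔽 1 (k : S.GG) (Φ (stdOne C σst w)) =
      Φ (stdOne C σst (σst k w)) := fun k w => by
    rw [← hΦ, indRep_stdOne]
  set v := Φ (stdOne C σst (φ (hL.indI 𝔽))) with hv
  have hR : hL.RInv v := by
    intro x i hi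
    have := hK ⟨i, hL.Iw_le_K hi⟩ (φ (hL.indI 𝔽))
    rw [hL.map_indI_fixed heq (hL.mem_II.2 hi), ← hv] at this
    exact congrFun (congrArg Subtype.val this) x
  refine ⟨hR, fun m hm => ?_⟩
  have hsum : ∑ x : C.K ⧸ hL.II, indRep C 𝔽 𝔽 1 (x.out : S.GG) v = 0 := by
    rw [hv, Finset.sum_congr rfl fun x _ => hK x.out _, ← map_sum, ← map_sum,
      hL.sum_map_indI hker heq, map_zero, map_zero]
  rw [← hL.sum_alpha hR hm]
  have := congrFun (congrArg Subtype.val hsum) (S.alphaE ^ m)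
  rw [coe_sum_indOne] at this
  exact this

end IsLevel

section

variable {S : Setting} {C : Chamber S} {r : ℤ} (hL : IsLevel C r) {𝔽 : Type} [Field 𝔽]
  {W V : Type} [AddCommGroup W] [Module 𝔽 W] [AddCommGroup V] [Module 𝔽 V]
  {σ : Representation 𝔽 C.K W} {ρ : Representation 𝔽 S.GG V}

/-- A `G`-map out of `ind_K^G σ` is determined by its value at `[1, v₀]`, for `v₀ ≠ 0`. -/
lemma hom_eq_zero_of_stdOne (hσ : IsWeight C 𝔽 W σ) {v0 : W} (hv0 : v0 ≠ 0)
    {Φ : IndSub C 𝔽 W σ →ₗ[𝔽] V} (hΦ : Φ ∈ EquivHomSub 𝔽 (indRep C 𝔽 W σ) ρ)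
    (h : Φ (stdOne C σ v0) = 0) : Φ = 0 := by
  refine eq_zero_of_stdOne C hΦ fun w => ?_
  have hinv := hσ.2.2.1 (LinearMap.ker (Φ.comp (stdOne C σ))) fun k w hw => by
    have hw' : Φ (stdOne C σ w) = 0 := hw
    show Φ (stdOne C σ (σ k w)) = 0
    rw [← indRep_stdOne, hΦ, hw', map_zero]
  have hmem : v0 ∈ LinearMap.ker (Φ.comp (stdOne C σ)) := h
  rcases hinv with hb | ht
  · rw [hb, Submodule.mem_bot] at hmem
    exact absurd hmem hv0
  · have : w ∈ LinearMap.ker (Φ.comp (stdOne C σ)) := ht ▸ Submodule.mem_top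
    exact this

include hL in
lemma IsLevel.fFamily_zero {v0 : W} {ff : ℤ → IndSub C 𝔽 W σ} (hff : IsFFamily C 𝔽 W σ v0 ff) :
    ff 0 = stdOne C σ v0 := by
  refine eq_stdOne C σ (by simpa using hff.2.2.2.2.2 0 le_rfl) fun g hg => ?_
  obtain ⟨k, hk, i, hi, rfl⟩ := hff.2.2.2.1 0 g hg
  simpa using C.K.mul_mem hk (hL.Iw_le_K (hL.I1_le_Iw hi))

end

/-- Every nonzero `f` in the span of `{f_{-n,1} : n ≥ 1}` is the image
of `f_{0,st}` under a nonzero `G`-map `S_f : ind_K^G st → ind_K^G 1`, and `f ↦ S_f` is an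
isomorphism from that span onto `Hom_G(ind_K^G st, ind_K^G 1)`. -/
theorem stmt10
    (S : Setting) (C : Chamber S)
    (𝔽 : Type) [Field 𝔽] [IsAlgClosed 𝔽] [Algebra (ZMod S.p) 𝔽]
    [Algebra.IsAlgebraic (ZMod S.p) 𝔽]
    (Wst : Type) [AddCommGroup Wst] [Module 𝔽 Wst]
    (σst : Representation 𝔽 ↥C.K Wst)
    (hstweight : IsWeight C 𝔽 Wst σst) (hst : IsSteinberg C 𝔽 σst)
    (v0st : Wst) (ffst : ℤ → ↥(IndSub C 𝔽 Wst σst))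
    (hffst : IsFFamily C 𝔽 Wst σst v0st ffst)
    (v0tr : 𝔽) (fftr : ℤ → ↥(IndSub C 𝔽 𝔽 (1 : Representation 𝔽 ↥C.K 𝔽)))
    (hfftr : IsFFamily C 𝔽 𝔽 (1 : Representation 𝔽 ↥C.K 𝔽) v0tr fftr) :
    (∀ f ∈ Submodule.span 𝔽 {v : ↥(IndSub C 𝔽 𝔽 (1 : Representation 𝔽 ↥C.K 𝔽)) |
        ∃ n : ℤ, 1 ≤ n ∧ v = fftr (-n)}, f ≠ 0 →
      ∃ Φ : ↥(IndSub C 𝔽 Wst σst) →ₗ[𝔽] ↥(IndSub C 𝔽 𝔽 (1 : Representation 𝔽 ↥C.K 𝔽)),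
        Φ ∈ EquivHomSub 𝔽 (indRep C 𝔽 Wst σst)
            (indRep C 𝔽 𝔽 (1 : Representation 𝔽 ↥C.K 𝔽)) ∧ Φ ≠ 0 ∧ Φ (ffst 0) = f) ∧
    ∃ e : ↥(Submodule.span 𝔽 {v : ↥(IndSub C 𝔽 𝔽 (1 : Representation 𝔽 ↥C.K 𝔽)) |
            ∃ n : ℤ, 1 ≤ n ∧ v = fftr (-n)}) ≃ₗ[𝔽]
          ↥(EquivHomSub 𝔽 (indRep C 𝔽 Wst σst)
              (indRep C 𝔽 𝔽 (1 : Representation 𝔽 ↥C.K 𝔽))),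
      ∀ v, ((e v : ↥(IndSub C 𝔽 Wst σst) →ₗ[𝔽]
          ↥(IndSub C 𝔽 𝔽 (1 : Representation 𝔽 ↥C.K 𝔽)))) (ffst 0) = ↑v := by
  obtain ⟨r, hL⟩ := exists_isLevel C
  have := hL.finite_quot
  have : Fintype (C.K ⧸ hL.II) := Fintype.ofFinite _
  have hI := hffst.2.1
  rw [hL.span_eq_Zsub hfftr, hL.fFamily_zero hffst]
  refine ⟨fun f hf hf0 => ?_, ?_⟩
  · obtain ⟨Φ, hΦ, h⟩ := hL.exists_hom_of_mem_Zsub hst hffst.1 hI hf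
    refine ⟨Φ, hΦ, ?_, h⟩
    rintro rfl
    exact hf0 h.symm
  · let ev : EquivHomSub 𝔽 (indRep C 𝔽 Wst σst) (indRep C 𝔽 𝔽 1) →ₗ[𝔽] hL.Zsub 𝔽 :=
      { toFun := fun Φ => ⟨Φ.1 (stdOne C σst v0st), hL.hom_apply_mem_Zsub hst hI Φ.2⟩
        map_add' := fun _ _ => rfl
        map_smul' := fun _ _ => rfl }
    have hbij : Function.Bijective ev := by
      refine ⟨fun Φ Ψ h => ?_, fun v => ?_⟩
      · refine Subtype.ext (sub_eq_zero.1 (hom_eq_zero_of_stdOne hstweight hffst.1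
          (Submodule.sub_mem _ Φ.2 Ψ.2) ?_))
        rw [LinearMap.sub_apply, sub_eq_zero]
        exact congrArg Subtype.val h
      · obtain ⟨Φ, hΦ, h⟩ := hL.exists_hom_of_mem_Zsub hst hffst.1 hI v.2
        exact ⟨⟨Φ, hΦ⟩, Subtype.ext h⟩
    refine ⟨(LinearEquiv.ofBijective ev hbij).symm, fun v => ?_⟩
    exact congrArg Subtype.val ((LinearEquiv.ofBijective ev hbij).apply_symm_apply v)

end U21
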